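/- arXiv:2406.05609 — 3 statements merged into one kernel-verified Lean document; each statement's English description precedes it below -/
import Mathlib

section
/- In the Setup with n ≥ 5, the induced subgraph G[A] contains at least one edge (equivalently, u* lies in at least one triangle of G), and B is nonempty. -/
open Matrix

/-- The spectral radius of a finite simple graph: the largest eigenvalue of its
adjacency matrix (as a real symmetric matrix), expressed as the supremum of the
set of eigenvalues of the associated linear endomorphism. -/
noncomputable def specRad {V : Type*} [Fintype V] (G : SimpleGraph V) : ℝ :=
  letI := Classical.decEq V
  letI := Classical.decRel G.Adj
  sSup {μ : ℝ | Module.End.HasEigenvalue (Matrix.toLin' (SimpleGraph.adjMatrix ℝ G)) μ}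

/-- The number of triangles (3-cliques) of a finite simple graph. -/
noncomputable def triangleCount {V : Type*} [Fintype V] (G : SimpleGraph V) : ℕ :=
  letI := Classical.decEq V
  letI := Classical.decRel G.Adj
  (G.cliqueFinset 3).card

/-- The graph on `Fin n` obtained from the complete bipartite graph with parts
`{0, …, a-1}` and `{a, …, n-1}` by adding the extra edge `{0, 1}` inside the
first part. -/
def KbipPlus (n a : ℕ) : SimpleGraph (Fin n) :=
  SimpleGraph.fromRel (fun u v => ((u : ℕ) < a ∧ a ≤ (v : ℕ)) ∨ ((u : ℕ) = 0 ∧ (v : ℕ) = 1))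

/-- `K⁺_{⌈n/2⌉,⌊n/2⌋}`: the complete bipartite graph with parts of sizes `⌈n/2⌉`
and `⌊n/2⌋` together with one extra edge inside the part of size `⌈n/2⌉`
(added between vertices `0` and `1`). -/
def Kplus (n : ℕ) : SimpleGraph (Fin n) := KbipPlus n ((n + 1) / 2)

/-- `K^{+|}`: the graph on `Fin n` obtained from the complete bipartite graph with
parts `{0, …, a-1}` and `{a, …, n-1}` by adding the edge `e₁ = {0, 1}` inside the
first part and deleting the cross edge `e₂ = {0, a}`, which shares the endpoint `0`
with `e₁`. -/
def KbipPlusMinus (n a : ℕ) : SimpleGraph (Fin n) :=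
  SimpleGraph.fromRel (fun u v =>
    (((u : ℕ) < a ∧ a ≤ (v : ℕ)) ∧ ¬((u : ℕ) = 0 ∧ (v : ℕ) = a)) ∨
      ((u : ℕ) = 0 ∧ (v : ℕ) = 1))

/-- The spectral radius bounds every Rayleigh quotient of the adjacency matrix. -/
theorem dotProduct_adjMatrix_mulVec_le_specRad {V : Type*} [Fintype V] [DecidableEq V]
    (H : SimpleGraph V) [DecidableRel H.Adj] (y : V → ℝ) :
    y ⬝ᵥ (H.adjMatrix ℝ *ᵥ y) ≤ specRad H * (y ⬝ᵥ y) := by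
  have key : ∀ μ : ℝ, Module.End.HasEigenvalue (Matrix.toLin' (H.adjMatrix ℝ)) μ →
      μ ≤ specRad H := by
    intro μ hμ
    have hfin : {μ : ℝ | Module.End.HasEigenvalue (Matrix.toLin' (H.adjMatrix ℝ)) μ}.Finite :=
      Module.End.finite_hasEigenvalue _
    unfold specRad
    refine le_csSup ?_ ?_
    · convert hfin.bddAbove
    · convert hμ
  have hM : (specRad H • (1 : Matrix V V ℝ) - H.adjMatrix ℝ).IsHermitian := by
    rw [Matrix.IsHermitian, Matrix.conjTranspose_eq_transpose_of_trivial]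
    simp
  have hpsd : (specRad H • (1 : Matrix V V ℝ) - H.adjMatrix ℝ).PosSemidef := by
    rw [hM.posSemidef_iff_eigenvalues_nonneg]
    intro i
    have hv := hM.mulVec_eigenvectorBasis i
    have hne : (⇑(hM.eigenvectorBasis i) : V → ℝ) ≠ 0 := by
      intro h
      apply hM.eigenvectorBasis.orthonormal.ne_zero i
      ext j
      exact congrFun h j
    have := key (specRad H - hM.eigenvalues i) (Module.End.hasEigenvalue_of_hasEigenvector
      (x := ⇑(hM.eigenvectorBasis i)) ⟨Module.End.mem_eigenspace_iff.2 ?_, hne⟩)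
    · simpa using this
    · rw [Matrix.toLin'_apply, sub_smul, ← hv, Matrix.sub_mulVec, Matrix.smul_mulVec,
        Matrix.one_mulVec, sub_sub_cancel]
  have h := hpsd.dotProduct_mulVec_nonneg y
  rw [star_trivial, Matrix.sub_mulVec, Matrix.smul_mulVec, Matrix.one_mulVec, dotProduct_sub,
    dotProduct_smul, smul_eq_mul] at h
  linarith

/-- The average degree is at most the spectral radius. -/
theorem sum_degree_le_specRad_mul_card {V : Type*} [Fintype V] [DecidableEq V]
    (H : SimpleGraph V) [DecidableRel H.Adj] :
    (∑ v, H.degree v : ℝ) ≤ specRad H * Fintype.card V := by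
  have h := dotProduct_adjMatrix_mulVec_le_specRad H (fun _ => 1)
  simpa [dotProduct, SimpleGraph.adjMatrix_mulVec_apply] using h

theorem le_sum_degree_Kplus {n : ℕ} (hn : 3 ≤ n) [DecidableRel (Kplus n).Adj] :
    2 * ((n + 1) / 2 * (n / 2) + 1) ≤ ∑ v, (Kplus n).degree v := by
  set a := (n + 1) / 2 with ha
  have h2 : 2 ≤ a := by omega
  have hcard : ∑ v, (Kplus n).degree v =
      ∑ v : Fin n, ∑ w : Fin n, if (Kplus n).Adj v w then 1 else 0 := by
    refine Finset.sum_congr rfl fun v _ => ?_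
    rw [← SimpleGraph.card_neighborFinset_eq_degree, SimpleGraph.neighborFinset_eq_filter,
      Finset.card_filter]
  let i : Fin n := ⟨0, by omega⟩
  let j : Fin n := ⟨1, by omega⟩
  have hpt : ∀ v w : Fin n,
      (if (v : ℕ) < a then 1 else 0) * (if a ≤ (w : ℕ) then 1 else 0) +
      (if (w : ℕ) < a then 1 else 0) * (if a ≤ (v : ℕ) then 1 else 0) +
      (if v = i then 1 else 0) * (if w = j then 1 else 0) +
      (if v = j then 1 else 0) * (if w = i then 1 else 0) ≤
      if (Kplus n).Adj v w then 1 else 0 := by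
    intro v w
    simp only [Kplus, KbipPlus, SimpleGraph.fromRel_adj, i, j, Fin.ext_iff, ne_eq]
    rw [← ha]
    split_ifs <;> omega
  have hlt : (∑ v : Fin n, if (v : ℕ) < a then 1 else 0) = a := by
    rw [Fin.sum_univ_eq_sum_range (fun k => if k < a then 1 else 0), ← Finset.card_filter]
    convert Finset.card_range a
    ext k
    simp only [Finset.mem_filter, Finset.mem_range]
    omega
  have hge : (∑ v : Fin n, if a ≤ (v : ℕ) then 1 else 0) = n / 2 := by
    rw [Fin.sum_univ_eq_sum_range (fun k => if a ≤ k then 1 else 0), ← Finset.card_filter]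
    trans (Finset.Ico a n).card
    · congr 1
      ext k
      simp only [Finset.mem_filter, Finset.mem_range, Finset.mem_Ico]
      omega
    · rw [Nat.card_Ico]
      omega
  rw [hcard]
  refine le_trans (le_of_eq ?_) (Finset.sum_le_sum fun v _ => Finset.sum_le_sum fun w _ => hpt v w)
  simp only [Finset.sum_add_distrib, ← Finset.mul_sum, ← Finset.sum_mul, hlt, hge]
  simp
  ring

theorem le_specRad_Kplus_mul {n : ℕ} (hn : 3 ≤ n) :
    (2 * ((n + 1) / 2 * (n / 2) + 1 : ℕ) : ℝ) ≤ specRad (Kplus n) * n := by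
  classical
  have h := sum_degree_le_specRad_mul_card (Kplus n)
  rw [Fintype.card_fin] at h
  refine le_trans ?_ h
  exact_mod_cast le_sum_degree_Kplus hn

/-- The graph `G` with all edges at `u` removed. -/
def isolate {V : Type*} (G : SimpleGraph V) (u : V) : SimpleGraph V where
  Adj v w := G.Adj v w ∧ v ≠ u ∧ w ≠ u
  symm := ⟨fun _ _ h => ⟨h.1.symm, h.2.2, h.2.1⟩⟩
  loopless := ⟨fun _ h => h.1.ne rfl⟩

@[simp]
theorem isolate_adj {V : Type*} (G : SimpleGraph V) (u v w : V) :
    (isolate G u).Adj v w ↔ G.Adj v w ∧ v ≠ u ∧ w ≠ u := Iff.rfl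

theorem triangleCount_eq {V : Type*} [Fintype V] [DecidableEq V] (G : SimpleGraph V)
    [DecidableRel G.Adj] : triangleCount G = (G.cliqueFinset 3).card := by
  unfold triangleCount
  convert rfl

/-- If `u` is adjacent to all other vertices, each edge avoiding `u` spans a triangle with `u`. -/
theorem card_edgeFinset_isolate_le_triangleCount {V : Type*} [Fintype V] [DecidableEq V]
    (G : SimpleGraph V) (u : V) [DecidableRel (isolate G u).Adj] (hu : ∀ v, v ≠ u → G.Adj u v) :
    (isolate G u).edgeFinset.card ≤ triangleCount G := by
  classical
  rw [triangleCount_eq]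
  refine Finset.card_le_card_of_injOn (fun e => insert u e.toFinset) ?_ ?_
  · intro e
    induction e with
    | _ a b =>
      intro he
      simp only [Finset.mem_coe, SimpleGraph.mem_edgeFinset, SimpleGraph.mem_edgeSet] at he
      obtain ⟨hab, ha, hb⟩ := he
      have h := SimpleGraph.is3Clique_triple_iff.2 ⟨hu a ha, hu b hb, hab⟩
      rw [Finset.mem_coe, SimpleGraph.mem_cliqueFinset_iff]
      convert h
      ext v
      simp
  · have hnot : ∀ e ∈ (isolate G u).edgeFinset, u ∉ e.toFinset := by
      intro e
      induction e with
      | _ a b =>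
        intro he
        simp only [SimpleGraph.mem_edgeFinset, SimpleGraph.mem_edgeSet] at he
        simp [he.2.1.symm, he.2.2.symm]
    intro e he f hf hef
    have h : e.toFinset = f.toFinset := by
      rw [← Finset.erase_insert (hnot e he), ← Finset.erase_insert (hnot f hf)]
      exact congrArg (fun s => Finset.erase s u) hef
    ext v
    rw [← Sym2.mem_toFinset, h, Sym2.mem_toFinset]

theorem degree_add_degree_le_card_edgeFinset_add_one {V : Type*} [Fintype V] [DecidableEq V]
    (H : SimpleGraph V) [DecidableRel H.Adj] {v w : V} (hvw : v ≠ w) :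
    H.degree v + H.degree w ≤ H.edgeFinset.card + 1 := by
  rw [← H.card_incidenceFinset_eq_degree, ← H.card_incidenceFinset_eq_degree,
    ← Finset.card_union_add_card_inter]
  gcongr
  · exact Finset.union_subset (H.incidenceFinset_subset v) (H.incidenceFinset_subset w)
  · rw [← Finset.card_singleton s(v, w)]
    refine Finset.card_le_card fun e he => ?_
    simp only [Finset.mem_inter, SimpleGraph.mem_incidenceFinset] at he
    simpa using H.incidenceSet_inter_incidenceSet_subset hvw he

theorem sum_degree_mul_le_of_card_edgeFinset_le_two {V : Type*} [Fintype V] [DecidableEq V]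
    (H : SimpleGraph V) [DecidableRel H.Adj] (hH : H.edgeFinset.card ≤ 2) (s : Finset V)
    (x : V → ℝ) {M : ℝ} (hx : ∀ v, 0 ≤ x v) (hM : ∀ v, x v ≤ M) (hM0 : 0 ≤ M) :
    ∑ v ∈ s, (H.degree v : ℝ) * x v ≤ ∑ v ∈ s, x v + M := by
  by_cases h : ∃ w ∈ s, 2 ≤ H.degree w
  · obtain ⟨w, hws, hw⟩ := h
    have hw2 : H.degree w ≤ 2 := (H.degree_le_card_edgeFinset w).trans hH
    rw [← Finset.add_sum_erase s _ hws, ← Finset.add_sum_erase s x hws]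
    have hsum : ∑ v ∈ s.erase w, (H.degree v : ℝ) * x v ≤ ∑ v ∈ s.erase w, x v := by
      refine Finset.sum_le_sum fun v hv => ?_
      have h1 := degree_add_degree_le_card_edgeFinset_add_one H (Finset.ne_of_mem_erase hv)
      have h2 : (H.degree v : ℝ) ≤ 1 := by exact_mod_cast (by omega : H.degree v ≤ 1)
      exact mul_le_of_le_one_left (hx v) h2
    have h2 : (H.degree w : ℝ) ≤ 2 := by exact_mod_cast hw2
    have := mul_le_mul_of_nonneg_right h2 (hx w)
    linarith [hM w]
  · push Not at h
    have : ∑ v ∈ s, (H.degree v : ℝ) * x v ≤ ∑ v ∈ s, x v := by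
      refine Finset.sum_le_sum fun v hv => mul_le_of_le_one_left (hx v) ?_
      exact_mod_cast Nat.lt_succ_iff.1 (h v hv)
    linarith

/-- If the neighbourhood of a vertex maximizing a nonnegative eigenvector is independent, the
eigenvalue is at most half the number of vertices. -/
theorem four_mul_sq_le_card_sq_of_neighborhood_independent {V : Type*} [Fintype V] [DecidableEq V]
    (G : SimpleGraph V) [DecidableRel G.Adj] {x : V → ℝ} {μ : ℝ} {u : V}
    (heig : G.adjMatrix ℝ *ᵥ x = μ • x) (hu : ∀ v, x v ≤ x u) (hpos : 0 < x u)
    (hind : ∀ a b, G.Adj u a → G.Adj u b → ¬ G.Adj a b) :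
    4 * μ ^ 2 ≤ (Fintype.card V : ℝ) ^ 2 := by
  have he : ∀ v, ∑ w ∈ G.neighborFinset v, x w = μ * x v := fun v => by
    rw [← SimpleGraph.adjMatrix_mulVec_apply, heig]
    rfl
  have hA : ∀ a ∈ G.neighborFinset u,
      μ * x a ≤ ((Fintype.card V : ℝ) - G.degree u) * x u := by
    intro a ha
    have hsub : G.neighborFinset a ⊆ (G.neighborFinset u)ᶜ := fun w hw => by
      rw [SimpleGraph.mem_neighborFinset] at ha hw
      simpa using fun h => hind a w ha h hw
    have hdeg := Finset.card_le_card hsub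
    rw [Finset.card_compl, SimpleGraph.card_neighborFinset_eq_degree,
      SimpleGraph.card_neighborFinset_eq_degree] at hdeg
    have hle : G.degree u ≤ Fintype.card V := Finset.card_le_univ _
    have hdeg' : (G.degree a : ℝ) ≤ (Fintype.card V : ℝ) - G.degree u := by
      rw [← Nat.cast_sub hle]
      exact_mod_cast hdeg
    calc μ * x a = ∑ w ∈ G.neighborFinset a, x w := (he a).symm
      _ ≤ ∑ w ∈ G.neighborFinset a, x u := Finset.sum_le_sum fun w _ => hu w
      _ = G.degree a * x u := by simp
      _ ≤ _ := mul_le_mul_of_nonneg_right hdeg' hpos.le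
  have hsum := Finset.sum_le_sum hA
  rw [← Finset.mul_sum, he u, Finset.sum_const, SimpleGraph.card_neighborFinset_eq_degree,
    nsmul_eq_mul, ← mul_assoc, ← mul_assoc] at hsum
  have := le_of_mul_le_mul_right hsum hpos
  nlinarith [sq_nonneg ((Fintype.card V : ℝ) - 2 * G.degree u)]

/-- The squared eigenvalue equation at a vertex `u` adjacent to all other vertices. -/
theorem sq_mul_eq_of_dominating {V : Type*} [Fintype V] [DecidableEq V]
    (G : SimpleGraph V) [DecidableRel G.Adj] {x : V → ℝ} {μ : ℝ} {u : V}
    [DecidableRel (isolate G u).Adj]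
    (heig : G.adjMatrix ℝ *ᵥ x = μ • x) (hu : ∀ v, v ≠ u → G.Adj u v) :
    μ ^ 2 * x u = ((Fintype.card V : ℝ) - 1) * x u +
      ∑ v ∈ Finset.univ.erase u, ((isolate G u).degree v : ℝ) * x v := by
  have he : ∀ v, ∑ w ∈ G.neighborFinset v, x w = μ * x v := fun v => by
    rw [← SimpleGraph.adjMatrix_mulVec_apply, heig]
    rfl
  have hN : G.neighborFinset u = Finset.univ.erase u := by
    ext v
    simpa using ⟨fun h => h.ne', hu v⟩
  have hv : ∀ v ∈ Finset.univ.erase u,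
      μ * x v = x u + ∑ w ∈ (isolate G u).neighborFinset v, x w := by
    intro v hv
    have hvu : v ≠ u := Finset.ne_of_mem_erase hv
    rw [← he v, ← Finset.add_sum_erase _ _ (show u ∈ G.neighborFinset v by
      simpa using (hu v hvu).symm)]
    congr 2
    ext w
    simp [hvu, and_comm]
  have hsymm : ∑ v ∈ Finset.univ.erase u, ∑ w ∈ (isolate G u).neighborFinset v, x w =
      ∑ v ∈ Finset.univ.erase u, ((isolate G u).degree v : ℝ) * x v := by
    rw [Finset.sum_comm' (t' := Finset.univ.erase u)
      (s' := fun w => (isolate G u).neighborFinset w)]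
    · simp
    · intro v w
      simp only [Finset.mem_erase, Finset.mem_univ, SimpleGraph.mem_neighborFinset, isolate_adj,
        G.adj_comm v w]
      tauto
  rw [pow_two, mul_assoc, ← he u, hN, Finset.mul_sum, Finset.sum_congr rfl hv,
    Finset.sum_add_distrib, hsymm, Finset.sum_const, Finset.card_erase_of_mem (Finset.mem_univ u),
    Finset.card_univ, nsmul_eq_mul, Nat.cast_sub (Fintype.card_pos_iff.2 ⟨u⟩), Nat.cast_one]

/-- In the Setup with `n ≥ 5`, `G[A]` contains an edge (equivalently `u*` lies in a
triangle), and `B = V ∖ (N(u*) ∪ {u*})` is nonempty. -/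
theorem setup_edge_in_nbhd_and_B_nonempty
    (n : ℕ) (hn : 3 ≤ n) (G : SimpleGraph (Fin n)) [DecidableRel G.Adj]
    (ht : triangleCount G ≤ n / 2)
    (hspec : specRad (Kplus n) ≤ specRad G)
    (hmaxspec : ∀ H : SimpleGraph (Fin n), triangleCount H ≤ n / 2 → specRad H ≤ specRad G)
    (hconn : G.Connected)
    (x : Fin n → ℝ) (hxpos : ∀ v, 0 < x v) (hxunit : ∑ v, x v ^ 2 = 1)
    (heig : SimpleGraph.adjMatrix ℝ G *ᵥ x = specRad G • x)
    (ustar : Fin n) (hustar : ∀ v, x v ≤ x ustar)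
    (hn5 : 5 ≤ n) :
    (∃ a b : Fin n, G.Adj ustar a ∧ G.Adj ustar b ∧ G.Adj a b) ∧
      (Finset.univ \ insert ustar (G.neighborFinset ustar)).Nonempty := by
  have hlow : (2 * ((n + 1) / 2 * (n / 2) + 1 : ℕ) : ℝ) ≤ specRad G * n :=
    (le_specRad_Kplus_mul hn).trans (mul_le_mul_of_nonneg_right hspec n.cast_nonneg)
  have hn0 : (0 : ℝ) < n := by exact_mod_cast (by omega : 0 < n)
  have hhalf : (n : ℝ) < 2 * specRad G := by
    have h : n * n < 4 * ((n + 1) / 2 * (n / 2) + 1) := by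
      obtain ⟨k, rfl | rfl⟩ := n.even_or_odd'
      · rw [show (2 * k + 1) / 2 = k by omega, show 2 * k / 2 = k by omega]
        nlinarith
      · rw [show (2 * k + 1 + 1) / 2 = k + 1 by omega, show (2 * k + 1) / 2 = k by omega]
        nlinarith
    have h' : (n * n : ℝ) < 4 * ((n + 1) / 2 * (n / 2) + 1 : ℕ) := by exact_mod_cast h
    nlinarith
  constructor
  · by_contra! hno
    have h := four_mul_sq_le_card_sq_of_neighborhood_independent G heig hustar (hxpos ustar)
      fun a b ha hb => hno a b ha hb
    rw [Fintype.card_fin] at h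
    nlinarith
  · by_contra hempty
    have hdom : ∀ v, v ≠ ustar → G.Adj ustar v := by
      intro v hv
      by_contra hadj
      exact hempty ⟨v, by simp [hv, hadj]⟩
    classical
    have hedges := (card_edgeFinset_isolate_le_triangleCount G ustar hdom).trans ht
    have hsq := sq_mul_eq_of_dominating G heig hdom
    rw [Fintype.card_fin] at hsq
    obtain rfl | hn6 := hn5.eq_or_lt
    · have h := sum_degree_mul_le_of_card_edgeFinset_le_two _ hedges (Finset.univ.erase ustar) x
        (fun v => (hxpos v).le) hustar (hxpos ustar).le
      have hN : ∑ v ∈ Finset.univ.erase ustar, x v = specRad G * x ustar := by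
        have := congrFun heig ustar
        rw [SimpleGraph.adjMatrix_mulVec_apply] at this
        rw [← smul_eq_mul, ← Pi.smul_apply, ← this]
        congr 1
        ext v
        simpa using ⟨hdom v, fun h => h.ne'⟩
      have hle : specRad G ^ 2 ≤ 5 + specRad G := by
        refine le_of_mul_le_mul_right ?_ (hxpos ustar)
        push_cast at hsq
        linarith
      norm_num at hlow
      nlinarith
    · have hsum : ∑ v ∈ Finset.univ.erase ustar, ((isolate G ustar).degree v : ℝ) * x v ≤
          2 * (n / 2 : ℕ) * x ustar := by
        calc _ ≤ ∑ v ∈ Finset.univ.erase ustar, ((isolate G ustar).degree v : ℝ) * x ustar :=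
              Finset.sum_le_sum fun v _ => mul_le_mul_of_nonneg_left (hustar v) (Nat.cast_nonneg _)
          _ ≤ ∑ v, ((isolate G ustar).degree v : ℝ) * x ustar :=
              Finset.sum_le_sum_of_subset_of_nonneg (Finset.subset_univ _) fun v _ _ =>
                mul_nonneg (Nat.cast_nonneg _) (hxpos ustar).le
          _ ≤ _ := by
              rw [← Finset.sum_mul]
              refine mul_le_mul_of_nonneg_right ?_ (hxpos ustar).le
              have := (isolate G ustar).sum_degrees_eq_twice_card_edges
              exact_mod_cast this.trans_le (Nat.mul_le_mul_left 2 hedges)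
      have hle : specRad G ^ 2 ≤ n - 1 + 2 * (n / 2 : ℕ) := by
        refine le_of_mul_le_mul_right ?_ (hxpos ustar)
        linarith
      obtain rfl | hn7 := (Nat.succ_le_of_lt hn6).eq_or_lt
      · norm_num at hlow hle
        nlinarith
      · have h : 4 * (n + 2 * (n / 2)) ≤ n * n + 4 := by
          obtain hn8 | rfl := (Nat.succ_le_of_lt hn7).lt_or_eq
          · have : 2 * (n / 2) ≤ n := by omega
            nlinarith
          · norm_num
        have h' : (4 * (n + 2 * (n / 2 : ℕ)) : ℝ) ≤ n * n + 4 := by exact_mod_cast h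
        nlinarith
end

section
/- In the Setup, writing t = t(G), the induced subgraph G[A] is the disjoint union of a star K_{1,t} and |A| − t − 1 isolated vertices; that is, the edges of G inside A form a star with t edges. -/
open Matrix

namespace SimpleGraph

section CliquesIn

variable {V : Type*} {G : SimpleGraph V} {s c : Finset V} {k : ℕ} {u v : V}

open Classical in
/-- The `k`-cliques of `G` all of whose vertices lie in `s`. -/
noncomputable def cliquesIn (G : SimpleGraph V) (s : Finset V) (k : ℕ) : Finset (Finset V) :=
  (s.powersetCard k).filter fun c => G.IsClique (c : Set V)

open Classical in
/-- The neighbors of `u` that lie in `s`. -/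
noncomputable def nbrIn (G : SimpleGraph V) (s : Finset V) (u : V) : Finset V :=
  s.filter (G.Adj u)

lemma mem_cliquesIn : c ∈ cliquesIn G s k ↔ c ⊆ s ∧ c.card = k ∧ G.IsClique (c : Set V) := by
  simp [cliquesIn, Finset.mem_powersetCard, and_assoc]

lemma mem_nbrIn : v ∈ nbrIn G s u ↔ v ∈ s ∧ G.Adj u v := by
  simp [nbrIn]

lemma card_cliquesIn_one : (cliquesIn G s 1).card = s.card := by
  have : cliquesIn G s 1 = s.powersetCard 1 := by
    ext c
    rw [mem_cliquesIn, Finset.mem_powersetCard]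
    refine ⟨fun h => ⟨h.1, h.2.1⟩, fun h => ⟨h.1, h.2, ?_⟩⟩
    obtain ⟨a, rfl⟩ := Finset.card_eq_one.1 h.2
    simp
  rw [this, Finset.card_powersetCard, Nat.choose_one_right]

lemma card_cliquesIn_two_le : (cliquesIn G s 2).card ≤ s.card.choose 2 := by
  rw [← Finset.card_powersetCard]
  exact Finset.card_le_card fun c hc =>
    Finset.mem_powersetCard.2 ⟨(mem_cliquesIn.1 hc).1, (mem_cliquesIn.1 hc).2.1⟩

lemma cliquesIn_two_subset_of_clique (hc : c ∈ cliquesIn G s k) {e : Finset V} (hec : e ⊆ c)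
    (he : e.card = 2) : e ∈ cliquesIn G s 2 := by
  obtain ⟨h1, -, h3⟩ := mem_cliquesIn.1 hc
  exact mem_cliquesIn.2 ⟨hec.trans h1, he, h3.subset (by exact_mod_cast hec)⟩

variable [DecidableEq V]

lemma card_filter_mem_cliquesIn (hu : u ∈ s) :
    ((cliquesIn G s (k + 1)).filter (u ∈ ·)).card = (cliquesIn G (nbrIn G s u) k).card := by
  refine Finset.card_bij' (fun c _ => c.erase u) (fun c _ => insert u c) ?_ ?_ ?_ ?_
  · intro c hc
    rw [Finset.mem_filter, mem_cliquesIn] at hc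
    obtain ⟨⟨h1, h2, h3⟩, h4⟩ := hc
    rw [mem_cliquesIn]
    refine ⟨fun w hw => ?_, ?_, h3.subset (by simp)⟩
    · rw [Finset.mem_erase] at hw
      exact mem_nbrIn.2 ⟨h1 hw.2, h3 h4 hw.2 hw.1.symm⟩
    · rw [Finset.card_erase_of_mem h4, h2, Nat.add_sub_cancel]
  · intro c hc
    rw [mem_cliquesIn] at hc
    obtain ⟨h1, h2, h3⟩ := hc
    have hnot : u ∉ c := fun h => G.irrefl (mem_nbrIn.1 (h1 h)).2
    rw [Finset.mem_filter, mem_cliquesIn]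
    refine ⟨⟨?_, ?_, ?_⟩, Finset.mem_insert_self _ _⟩
    · exact Finset.insert_subset hu fun w hw => (mem_nbrIn.1 (h1 hw)).1
    · rw [Finset.card_insert_of_notMem hnot, h2]
    · rw [Finset.coe_insert]
      exact h3.insert fun w hw _ => (mem_nbrIn.1 (h1 hw)).2
  · intro c hc
    exact Finset.insert_erase (Finset.mem_filter.1 hc).2
  · intro c hc
    exact Finset.erase_insert fun h => G.irrefl (mem_nbrIn.1 ((mem_cliquesIn.1 hc).1 h)).2

/-- Cliques either avoid `u` or consist of `u` and a clique among the neighbors of `u`. -/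
lemma card_cliquesIn_succ (hu : u ∈ s) :
    (cliquesIn G s (k + 1)).card =
      (cliquesIn G (s.erase u) (k + 1)).card + (cliquesIn G (nbrIn G s u) k).card := by
  rw [← card_filter_mem_cliquesIn hu, ← Finset.card_filter_add_card_filter_not (u ∈ ·), add_comm]
  congr 2
  ext c
  simp only [Finset.mem_filter, mem_cliquesIn, Finset.subset_erase]
  tauto

lemma sum_card_cliquesIn_nbrIn :
    ∑ u ∈ s, (cliquesIn G (nbrIn G s u) k).card = (k + 1) * (cliquesIn G s (k + 1)).card := by
  rw [Finset.sum_congr rfl fun u hu => (card_filter_mem_cliquesIn (k := k) hu).symm]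
  have := Finset.sum_card_bipartiteAbove_eq_sum_card_bipartiteBelow
    (s := s) (t := cliquesIn G s (k + 1)) (fun u c => u ∈ c)
  simp only [Finset.bipartiteAbove, Finset.bipartiteBelow] at this
  rw [this, Finset.sum_congr rfl (g := fun _ => k + 1)]
  · simp [mul_comm]
  · intro c hc
    obtain ⟨h1, h2, -⟩ := mem_cliquesIn.1 hc
    rw [Finset.filter_mem_eq_inter, Finset.inter_eq_right.2 h1, h2]

lemma exists_adj_of_mem_cliquesIn_two {e : Finset V} (he : e ∈ cliquesIn G s 2) :
    ∃ u v, e = {u, v} ∧ u ∈ s ∧ v ∈ s ∧ G.Adj u v := by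
  obtain ⟨h1, h2, h3⟩ := mem_cliquesIn.1 he
  obtain ⟨u, v, huv, rfl⟩ := Finset.card_eq_two.1 h2
  exact ⟨u, v, rfl, h1 (by simp), h1 (by simp), h3 (by simp) (by simp) huv⟩

lemma insert_pair_mem_cliquesIn {w : V} (hu : u ∈ s) (hv : v ∈ s) (hw : w ∈ s) (huv : G.Adj u v)
    (huw : G.Adj u w) (hvw : G.Adj v w) : {u, v, w} ∈ cliquesIn G s 3 := by
  rw [mem_cliquesIn]
  have h : G.IsNClique 3 {u, v, w} := is3Clique_triple_iff.2 ⟨huv, huw, hvw⟩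
  refine ⟨?_, h.card_eq, h.isClique⟩
  simp [Finset.insert_subset_iff, hu, hv, hw]

/-- Deleting the edge `{u, v}` destroys exactly the cliques containing both `u` and `v`. -/
lemma cliquesIn_deleteEdges (huv : u ≠ v) :
    cliquesIn (G.deleteEdges {s(u, v)}) s k = (cliquesIn G s k).filter (¬ {u, v} ⊆ ·) := by
  ext c
  simp only [Finset.mem_filter, mem_cliquesIn, and_assoc, and_congr_right_iff]
  intro _ _
  constructor
  · intro h
    refine ⟨fun a ha b hb hab => (deleteEdges_adj.1 (h ha hb hab)).1, fun hsub => ?_⟩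
    have := h (x := u) (hsub (by simp)) (y := v) (hsub (by simp)) huv
    simp at this
  · rintro ⟨h, hsub⟩ a ha b hb hab
    refine deleteEdges_adj.2 ⟨h ha hb hab, fun hmem => hsub ?_⟩
    rw [Set.mem_singleton_iff, Sym2.eq_iff] at hmem
    rcases hmem with ⟨rfl, rfl⟩ | ⟨rfl, rfl⟩ <;>
      simp [Finset.insert_subset_iff, Finset.mem_coe.1 ha, Finset.mem_coe.1 hb]

/-- Deleting an edge lowers the number of edges by one. -/
lemma card_cliquesIn_two_deleteEdges (hu : u ∈ s) (hv : v ∈ s) (huv : G.Adj u v) :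
    (cliquesIn (G.deleteEdges {s(u, v)}) s 2).card + 1 = (cliquesIn G s 2).card := by
  have hmem : {u, v} ∈ cliquesIn G s 2 := by
    refine mem_cliquesIn.2 ⟨by simp [Finset.insert_subset_iff, hu, hv],
      Finset.card_pair huv.ne, ?_⟩
    simpa [isClique_pair] using fun _ => huv
  have : cliquesIn (G.deleteEdges {s(u, v)}) s 2 = (cliquesIn G s 2).erase {u, v} := by
    rw [cliquesIn_deleteEdges huv.ne]
    ext c
    rw [Finset.mem_filter, Finset.mem_erase, and_comm]
    refine and_congr_left fun hc => not_congr ⟨fun h => ?_, fun h => h ▸ subset_rfl⟩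
    refine (Finset.eq_of_subset_of_card_le h ?_).symm
    rw [(mem_cliquesIn.1 hc).2.1, Finset.card_pair huv.ne]
  rw [this, Finset.card_erase_add_one hmem]

lemma nbrIn_erase : nbrIn G (s.erase u) v = (nbrIn G s v).erase u := by
  ext w
  simp only [mem_nbrIn, Finset.mem_erase]
  tauto

/-- If every edge inside `s` lies in a triangle inside `s`, there are at most three times as many
edges as triangles. -/
lemma card_cliquesIn_two_le_three_mul
    (h : ∀ e ∈ cliquesIn G s 2, ∃ c ∈ cliquesIn G s 3, e ⊆ c) :
    (cliquesIn G s 2).card ≤ 3 * (cliquesIn G s 3).card := by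
  have hsub : cliquesIn G s 2 ⊆ (cliquesIn G s 3).biUnion (Finset.powersetCard 2) := by
    intro e he
    obtain ⟨c, hc, hec⟩ := h e he
    exact Finset.mem_biUnion.2
      ⟨c, hc, Finset.mem_powersetCard.2 ⟨hec, (mem_cliquesIn.1 he).2.1⟩⟩
  refine (Finset.card_le_card hsub).trans ?_
  rw [mul_comm]
  refine Finset.card_biUnion_le_card_mul _ _ _ fun c hc => ?_
  rw [Finset.card_powersetCard, (mem_cliquesIn.1 hc).2.1]
  rfl

/-- If the neighborhoods of `u` and `v` cover `s`, every triangle inside `s` has an edge inside one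
of them, which moreover avoids `u` in the second case. -/
lemma exists_subset_of_nbrIn_cover (hcov : s ⊆ nbrIn G s u ∪ nbrIn G s v)
    (hc : c ∈ cliquesIn G s 3) :
    ∃ e ∈ cliquesIn G (nbrIn G s u) 2 ∪ cliquesIn G (nbrIn G (s.erase u) v) 2, e ⊆ c := by
  obtain ⟨h1, h2, h3⟩ := mem_cliquesIn.1 hc
  have key : ∀ X : Finset V, 2 ≤ (c ∩ X).card → ∃ e ∈ cliquesIn G X 2, e ⊆ c := by
    intro X hX
    obtain ⟨e, he, hecard⟩ := Finset.exists_subset_card_eq hX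
    refine ⟨e, mem_cliquesIn.2 ⟨he.trans Finset.inter_subset_right, hecard, h3.subset ?_⟩,
      he.trans Finset.inter_subset_left⟩
    exact_mod_cast he.trans Finset.inter_subset_left
  by_cases hA : 2 ≤ (c ∩ nbrIn G s u).card
  · obtain ⟨e, he, hec⟩ := key _ hA
    exact ⟨e, Finset.mem_union_left _ he, hec⟩
  · have huc : u ∉ c := by
      intro huc
      refine hA ?_
      rw [show 2 = (c.erase u).card by rw [Finset.card_erase_of_mem huc, h2]]
      refine Finset.card_le_card fun w hw => ?_
      rw [Finset.mem_erase] at hw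
      exact Finset.mem_inter.2 ⟨hw.2, mem_nbrIn.2 ⟨h1 hw.2, h3 huc hw.2 hw.1.symm⟩⟩
    have hsub : c ⊆ (c ∩ nbrIn G s u) ∪ (c ∩ nbrIn G (s.erase u) v) := by
      intro w hw
      have hwu : w ≠ u := fun h => huc (h ▸ hw)
      have := hcov (h1 hw)
      simp only [Finset.mem_union, Finset.mem_inter, nbrIn_erase, Finset.mem_erase] at this ⊢
      tauto
    have := (Finset.card_le_card hsub).trans (Finset.card_union_le _ _)
    obtain ⟨e, he, hec⟩ := key (nbrIn G (s.erase u) v) (by omega)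
    exact ⟨e, Finset.mem_union_right _ he, hec⟩

/-- A graph on `n` vertices with more than `n² / 4` edges has at least `n / 2` triangles, and if it
has no more than that, all its triangles share an edge. -/
theorem rademacher_cliquesIn (n : ℕ) : ∀ (G : SimpleGraph V) (s : Finset V), s.card = n →
    n ^ 2 / 4 + 1 ≤ (cliquesIn G s 2).card →
    n / 2 ≤ (cliquesIn G s 3).card ∧ 1 ≤ (cliquesIn G s 3).card ∧
      ((cliquesIn G s 3).card ≤ n / 2 → ∃ e ∈ cliquesIn G s 2, ∀ c ∈ cliquesIn G s 3, e ⊆ c) := by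
  induction n using Nat.twoStepInduction with
  | zero =>
    intro G s hs hm
    have := card_cliquesIn_two_le (G := G) (s := s)
    simp [hs] at this
    simp [this] at hm
  | one =>
    intro G s hs hm
    have := card_cliquesIn_two_le (G := G) (s := s)
    simp [hs] at this
    simp [this] at hm
  | more n ih _ =>
    intro G s hs hm
    have harith : (n + 2) ^ 2 / 4 = n ^ 2 / 4 + n + 1 := by
      rw [show (n + 2) ^ 2 = n ^ 2 + (n + 1) * 4 by ring]
      omega
    have hhalf : (n + 2) / 2 = n / 2 + 1 := by omega
    rw [harith] at hm
    rw [hhalf]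
    by_cases hall : ∀ e ∈ cliquesIn G s 2, ∃ c ∈ cliquesIn G s 3, e ⊆ c
    · have h3 := card_cliquesIn_two_le_three_mul hall
      have hsmall : n / 2 + 1 ≤ (cliquesIn G s 3).card ∧
          ((cliquesIn G s 3).card ≤ n / 2 + 1 → n ≤ 2) := by
        have : n ^ 2 / 4 + n + 2 ≤ 3 * (cliquesIn G s 3).card := by omega
        rcases le_or_gt n 3 with h | h
        · interval_cases n <;> omega
        · have h4 : 4 * n ≤ n ^ 2 := by nlinarith
          have h5 : n / 2 + 1 < (cliquesIn G s 3).card := by omega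
          exact ⟨h5.le, fun h => absurd h h5.not_ge⟩
      refine ⟨hsmall.1, by omega, fun hle => ?_⟩
      have hn2 := hsmall.2 hle
      obtain ⟨c, hc⟩ := Finset.card_pos.1 (show 0 < (cliquesIn G s 3).card by omega)
      by_cases hd : ∃ d ∈ cliquesIn G s 3, d ≠ c
      · obtain ⟨d, hd, hdc⟩ := hd
        have hc' := mem_cliquesIn.1 hc
        have hd' := mem_cliquesIn.1 hd
        have hT : cliquesIn G s 3 = {c, d} := by
          refine (Finset.eq_of_subset_of_card_le ?_ ?_).symm
          · simp [Finset.insert_subset_iff, hc, hd]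
          · rw [Finset.card_pair hdc.symm]
            omega
        have hun := Finset.card_le_card (Finset.union_subset hc'.1 hd'.1)
        have hie := Finset.card_union_add_card_inter c d
        obtain ⟨e, he, hecard⟩ := Finset.exists_subset_card_eq (s := c ∩ d) (n := 2) (by omega)
        refine ⟨e, cliquesIn_two_subset_of_clique hc (he.trans Finset.inter_subset_left) hecard, ?_⟩
        rw [hT]
        simp [he.trans Finset.inter_subset_left, he.trans Finset.inter_subset_right]
      · push Not at hd
        obtain ⟨e, he, hecard⟩ := Finset.exists_subset_card_eq (s := c) (n := 2)
          (by rw [(mem_cliquesIn.1 hc).2.1]; norm_num)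
        refine ⟨e, cliquesIn_two_subset_of_clique hc he hecard, fun d hdm => ?_⟩
        rw [hd d hdm]
        exact he
    · push Not at hall
      obtain ⟨e, he, hno⟩ := hall
      obtain ⟨u, v, rfl, hu, hv, huv⟩ := exists_adj_of_mem_cliquesIn_two he
      have hvu : v ∈ s.erase u := Finset.mem_erase.2 ⟨huv.ne', hv⟩
      have hdisj : Disjoint (nbrIn G s u) (nbrIn G s v) := by
        rw [Finset.disjoint_left]
        intro w hw hw'
        rw [mem_nbrIn] at hw hw'
        exact hno _ (insert_pair_mem_cliquesIn hu hv hw.1 huv hw.2 hw'.2)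
          (by simp [Finset.insert_subset_iff])
      have hdeg := Finset.card_union_of_disjoint hdisj
      have hunion : nbrIn G s u ∪ nbrIn G s v ⊆ s :=
        Finset.union_subset (fun w hw => (mem_nbrIn.1 hw).1) fun w hw => (mem_nbrIn.1 hw).1
      have hdegle := Finset.card_le_card hunion
      have hdv : (nbrIn G (s.erase u) v).card + 1 = (nbrIn G s v).card := by
        rw [nbrIn_erase]
        exact Finset.card_erase_add_one (mem_nbrIn.2 ⟨hu, huv.symm⟩)
      have hm1 := card_cliquesIn_succ (G := G) (k := 1) hu
      have hm2 := card_cliquesIn_succ (G := G) (k := 1) hvu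
      have ht1 := card_cliquesIn_succ (G := G) (k := 2) hu
      have ht2 := card_cliquesIn_succ (G := G) (k := 2) hvu
      rw [card_cliquesIn_one] at hm1 hm2
      norm_num at hm1 hm2 ht1 ht2
      set s' := (s.erase u).erase v with hs'
      have hscard : s'.card = n := by
        have := Finset.card_erase_add_one hvu
        rw [← hs'] at this
        have := Finset.card_erase_add_one hu
        omega
      obtain ⟨hI1, hI2, hI3⟩ := ih G s' hscard (by omega)
      rcases hdegle.lt_or_eq with hlt | heq
      · have hremove : ∀ e ∈ cliquesIn G s' 2,
            n / 2 ≤ ((cliquesIn G s' 3).filter (¬ e ⊆ ·)).card ∧ (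
            ((cliquesIn G s' 3).filter (¬ e ⊆ ·)).card ≤ n / 2 →
              ∃ f ∈ cliquesIn G s' 2, ∀ c ∈ cliquesIn G s' 3, e ⊆ c ∨ f ⊆ c) := by
          intro e he
          obtain ⟨p, q, rfl, hp, hq, hpq⟩ := exists_adj_of_mem_cliquesIn_two he
          have hcard := card_cliquesIn_two_deleteEdges hp hq hpq
          obtain ⟨h1, -, h2⟩ := ih (G.deleteEdges {s(p, q)}) s' hscard (by omega)
          rw [cliquesIn_deleteEdges hpq.ne] at h1 h2
          refine ⟨h1, fun h => ?_⟩
          obtain ⟨f, hf, hfc⟩ := h2 h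
          rw [cliquesIn_deleteEdges hpq.ne] at hf
          refine ⟨f, (Finset.mem_filter.1 hf).1, fun c hc => ?_⟩
          by_cases hpc : {p, q} ⊆ c
          · exact Or.inl hpc
          · exact Or.inr (hfc c (Finset.mem_filter.2 ⟨hc, hpc⟩))
        obtain ⟨c, hc⟩ := Finset.card_pos.1 hI2
        obtain ⟨e, hec, hecard⟩ := Finset.exists_subset_card_eq (s := c) (n := 2)
          (by rw [(mem_cliquesIn.1 hc).2.1]; norm_num)
        have hsplit := Finset.card_filter_add_card_filter_not (s := cliquesIn G s' 3) (e ⊆ ·)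
        have hcpos : 0 < ((cliquesIn G s' 3).filter (e ⊆ ·)).card :=
          Finset.card_pos.2 ⟨c, Finset.mem_filter.2 ⟨hc, hec⟩⟩
        obtain ⟨he1, he2⟩ := hremove e (cliquesIn_two_subset_of_clique hc hec hecard)
        refine ⟨by omega, by omega, fun hle => ?_⟩
        exfalso
        obtain ⟨f, hf, hef⟩ := he2 (by omega)
        have hf1 := (hremove f hf).1
        have hfle : ((cliquesIn G s' 3).filter (¬ f ⊆ ·)).card ≤
            ((cliquesIn G s' 3).filter (e ⊆ ·)).card := by
          refine Finset.card_le_card fun d hd => ?_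
          rw [Finset.mem_filter] at hd ⊢
          exact ⟨hd.1, (hef d hd.1).resolve_right hd.2⟩
        have hn3 : n ≤ 3 := by omega
        have hchoose := card_cliquesIn_two_le (G := G) (s := s')
        rw [hscard] at hchoose
        have hm' : n ^ 2 / 4 + 2 ≤ n.choose 2 := by omega
        clear * - hn3 hm'
        interval_cases n <;> simp [Nat.choose] at hm'
      · have hcov : s ⊆ nbrIn G s u ∪ nbrIn G s v :=
          (Finset.eq_of_subset_of_card_le hunion heq.ge).ge
        obtain ⟨c, hc⟩ := Finset.card_pos.1 (show 0 < (cliquesIn G s 3).card by omega)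
        obtain ⟨e, he, -⟩ := exists_subset_of_nbrIn_cover hcov hc
        have hF := Finset.card_union_le (cliquesIn G (nbrIn G s u) 2)
          (cliquesIn G (nbrIn G (s.erase u) v) 2)
        have hFpos := Finset.card_pos.2 ⟨e, he⟩
        refine ⟨by omega, by omega, fun hle => ?_⟩
        obtain ⟨f, hf⟩ := Finset.card_eq_one.1 (show
          (cliquesIn G (nbrIn G s u) 2 ∪ cliquesIn G (nbrIn G (s.erase u) v) 2).card = 1 by omega)
        have hfc : ∀ c ∈ cliquesIn G s 3, f ⊆ c := by
          intro c hc
          obtain ⟨e, he, hec⟩ := exists_subset_of_nbrIn_cover hcov hc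
          rw [hf, Finset.mem_singleton] at he
          exact he ▸ hec
        refine ⟨f, cliquesIn_two_subset_of_clique hc (hfc c hc) ?_, hfc⟩
        have : f ∈ cliquesIn G (nbrIn G s u) 2 ∪ cliquesIn G (nbrIn G (s.erase u) v) 2 := by
          rw [hf]; simp
        rcases Finset.mem_union.1 this with h | h <;> exact (mem_cliquesIn.1 h).2.1

end CliquesIn

section Perron

variable {V : Type*} {G : SimpleGraph V} {x : V → ℝ} {l M : ℝ}

lemma sum_card_nbrIn [DecidableEq V] (s : Finset V) :
    ∑ v ∈ s, (nbrIn G s v).card = 2 * (cliquesIn G s 2).card := by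
  rw [← sum_card_cliquesIn_nbrIn]
  exact Finset.sum_congr rfl fun v _ => card_cliquesIn_one.symm

variable [Fintype V]

lemma sum_sum_nbrIn_comm (f : V → V → ℝ) :
    ∑ v, ∑ w ∈ nbrIn G Finset.univ v, f v w = ∑ v, ∑ w ∈ nbrIn G Finset.univ v, f w v :=
  Finset.sum_comm' fun v w => by simp [mem_nbrIn, G.adj_comm]

/-- A bound on an eigenvalue with nonnegative eigenvector by numbers of edges and triangles. -/
lemma sq_mul_sum_le [DecidableEq V] (hx : ∀ v, 0 ≤ x v) (hM : ∀ v, x v ≤ M)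
    (heig : ∀ v, ∑ w ∈ nbrIn G Finset.univ v, x w = l * x v) :
    l ^ 2 * ∑ v, x v ≤ (cliquesIn G Finset.univ 2).card * ∑ v, x v +
      3 * (cliquesIn G Finset.univ 3).card * M := by
  set S := ∑ v, x v with hS
  have hedge : ∀ v, ∀ w ∈ nbrIn G Finset.univ v,
      l * x v + l * x w ≤ S + (nbrIn G (nbrIn G Finset.univ v) w).card * M := by
    intro v w _
    rw [← heig v, ← heig w, ← Finset.sum_union_inter]
    refine add_le_add (Finset.sum_le_univ_sum_of_nonneg hx) ?_
    rw [show nbrIn G Finset.univ v ∩ nbrIn G Finset.univ w =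
      nbrIn G (nbrIn G Finset.univ v) w by ext; simp [mem_nbrIn], ← nsmul_eq_mul]
    exact Finset.sum_le_card_nsmul _ _ _ fun a _ => hM a
  have hsum := Finset.sum_le_sum fun v (_ : v ∈ Finset.univ) => Finset.sum_le_sum (hedge v)
  have h1 : ∑ v, ∑ w ∈ nbrIn G Finset.univ v, l * x w = l ^ 2 * S := by
    simp_rw [← Finset.mul_sum, heig]
    rw [← Finset.mul_sum, ← hS]
    ring
  have h2 : ∑ v, ∑ w ∈ nbrIn G Finset.univ v, l * x v = l ^ 2 * S := by
    rw [sum_sum_nbrIn_comm, h1]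
  have h3 : ∑ v, ∑ _w ∈ nbrIn G Finset.univ v, S = 2 * (cliquesIn G Finset.univ 2).card * S := by
    simp only [Finset.sum_const, nsmul_eq_mul]
    rw [← Finset.sum_mul]
    congr 1
    exact_mod_cast sum_card_nbrIn (G := G) Finset.univ
  have h4 : ∑ v, ∑ w ∈ nbrIn G Finset.univ v, ((nbrIn G (nbrIn G Finset.univ v) w).card : ℝ) * M =
      6 * (cliquesIn G Finset.univ 3).card * M := by
    simp_rw [← Finset.sum_mul]
    congr 1
    have h : ∑ v, ∑ w ∈ nbrIn G Finset.univ v, (nbrIn G (nbrIn G Finset.univ v) w).card =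
        6 * (cliquesIn G Finset.univ 3).card := by
      simp_rw [sum_card_nbrIn]
      rw [← Finset.mul_sum, sum_card_cliquesIn_nbrIn]
      ring
    exact_mod_cast h
  simp only [Finset.sum_add_distrib] at hsum
  rw [h1, h2, h3, h4] at hsum
  linarith

/-- Counting walks of length two from a vertex `u` with maximal entry. -/
lemma sq_mul_apply_le [DecidableEq V] (hx : ∀ v, 0 ≤ x v) {u : V} (hM : ∀ v, x v ≤ x u)
    (heig : ∀ v, ∑ w ∈ nbrIn G Finset.univ v, x w = l * x v) :
    l ^ 2 * x u ≤ (nbrIn G Finset.univ u).card * x u +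
      2 * (cliquesIn G (nbrIn G Finset.univ u) 2).card * x u +
      (nbrIn G Finset.univ u).card * ∑ w ∈ (insert u (nbrIn G Finset.univ u))ᶜ, x w := by
  set A := nbrIn G Finset.univ u with hA
  have hv : ∀ v ∈ A, l * x v ≤ x u + (nbrIn G A v).card * x u + ∑ w ∈ (insert u A)ᶜ, x w := by
    intro v _
    have hsub : nbrIn G Finset.univ v ⊆ insert u (nbrIn G A v) ∪ (insert u A)ᶜ := by
      intro w hw
      simp only [Finset.mem_union, Finset.mem_insert, Finset.mem_compl, mem_nbrIn] at hw ⊢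
      tauto
    have hu : u ∉ nbrIn G A v := fun h => G.irrefl (mem_nbrIn.1 (mem_nbrIn.1 h).1).2
    have hdis : Disjoint (insert u (nbrIn G A v)) (insert u A)ᶜ := by
      rw [disjoint_compl_right_iff]
      exact Finset.insert_subset_insert _ fun w hw => (mem_nbrIn.1 hw).1
    rw [← heig v]
    refine (Finset.sum_le_sum_of_subset_of_nonneg hsub fun w _ _ => hx w).trans ?_
    rw [Finset.sum_union hdis, Finset.sum_insert hu, ← nsmul_eq_mul]
    gcongr
    exact Finset.sum_le_card_nsmul _ _ _ fun a _ => hM a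
  have hsum := Finset.sum_le_sum hv
  rw [← Finset.mul_sum, hA, heig, ← hA] at hsum
  simp only [Finset.sum_add_distrib, Finset.sum_const, nsmul_eq_mul, ← Finset.sum_mul] at hsum
  have h : ∑ v ∈ A, ((nbrIn G A v).card : ℝ) = 2 * (cliquesIn G A 2).card := by
    exact_mod_cast sum_card_nbrIn (G := G) A
  rw [h] at hsum
  linarith

lemma sum_compl_insert_nbrIn [DecidableEq V] (u : V)
    (heig : ∀ v, ∑ w ∈ nbrIn G Finset.univ v, x w = l * x v) :
    ∑ v, x v = x u + l * x u + ∑ w ∈ (insert u (nbrIn G Finset.univ u))ᶜ, x w := by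
  rw [← Finset.sum_add_sum_compl (insert u (nbrIn G Finset.univ u)), Finset.sum_insert, heig]
  exact fun h => G.irrefl (mem_nbrIn.1 h).2

end Perron

section SpecRad

lemma le_specRad {V : Type*} [Fintype V] (H : SimpleGraph V) [DecidableRel H.Adj]
    {r : ℝ} {y : V → ℝ} (hy : y ≠ 0)
    (heig : ∀ v, ∑ w, (if H.Adj v w then y w else 0) = r * y v) : r ≤ specRad H := by
  classical
  unfold specRad
  refine le_csSup (Module.End.finite_hasEigenvalue _).bddAbove ?_
  refine Module.End.hasEigenvalue_of_hasEigenvector (x := y) ⟨?_, hy⟩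
  rw [Module.End.mem_eigenspace_iff]
  ext v
  rw [Matrix.toLin'_apply, Pi.smul_apply, smul_eq_mul, ← heig v]
  simp only [Matrix.mulVec, dotProduct, adjMatrix_apply]
  refine Finset.sum_congr rfl fun w _ => ?_
  split_ifs <;> simp

lemma le_specRad_KbipPlus {k b : ℕ} {r : ℝ} (hb : 0 < b) (hr : 1 < r)
    (hroot : (r ^ 2 - (k + 2) * b) * (r - 1) = 2 * b) :
    r ≤ specRad (KbipPlus (k + 2 + b) (k + 2)) := by
  classical
  set Y : ℕ → ℝ := fun i => if i < 2 then b * r else if i < k + 2 then b * (r - 1) else r * (r - 1)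
    with hY
  refine le_specRad _ (y := fun v => Y v) (fun h => ?_) fun v => ?_
  · have := congrFun h ⟨0, by omega⟩
    simp [hY] at this
    rcases this with h | h
    · omega
    · linarith
  · have hsum : ∑ w : Fin (k + 2 + b),
        (if (KbipPlus (k + 2 + b) (k + 2)).Adj v w then Y w else 0) =
        ∑ i ∈ Finset.range (k + 2 + b),
          if ((v : ℕ) < k + 2 ∧ k + 2 ≤ i ∨ i < k + 2 ∧ k + 2 ≤ (v : ℕ)) ∨
            ((v : ℕ) = 0 ∧ i = 1 ∨ (v : ℕ) = 1 ∧ i = 0) then Y i else 0 := by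
      rw [Finset.sum_range]
      refine Finset.sum_congr rfl fun w _ => ?_
      congr 1
      simp only [KbipPlus, fromRel_adj, ne_eq, Fin.ext_iff, eq_iff_iff]
      omega
    have hL : ∀ i ∈ Finset.range k,
        (if ((v : ℕ) < k + 2 ∧ k + 2 ≤ i + 1 + 1 ∨ i + 1 + 1 < k + 2 ∧ k + 2 ≤ (v : ℕ)) ∨
          ((v : ℕ) = 0 ∧ i + 1 + 1 = 1 ∨ (v : ℕ) = 1 ∧ i + 1 + 1 = 0) then Y (i + 1 + 1) else 0) =
        if k + 2 ≤ (v : ℕ) then b * (r - 1) else 0 := by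
      intro i hi
      rw [Finset.mem_range] at hi
      refine if_congr (by omega) ?_ rfl
      simp only [hY]
      rw [if_neg (by omega), if_pos (by omega)]
    have hR : ∀ i ∈ Finset.range b,
        (if ((v : ℕ) < k + 2 ∧ k + 2 ≤ k + 2 + i ∨ k + 2 + i < k + 2 ∧ k + 2 ≤ (v : ℕ)) ∨
          ((v : ℕ) = 0 ∧ k + 2 + i = 1 ∨ (v : ℕ) = 1 ∧ k + 2 + i = 0) then Y (k + 2 + i) else 0) =
        if (v : ℕ) < k + 2 then r * (r - 1) else 0 := by
      intro i _
      refine if_congr (by omega) ?_ rfl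
      simp only [hY]
      rw [if_neg (by omega), if_neg (by omega)]
    rw [hsum, Finset.sum_range_add, Finset.sum_range_succ', Finset.sum_range_succ',
      Finset.sum_congr rfl hL, Finset.sum_congr rfl hR]
    have hY2 : ∀ i < 2, Y i = b * r := fun i hi => if_pos hi
    rw [hY2 (0 + 1) (by norm_num), hY2 0 (by norm_num)]
    simp only [Finset.sum_const, Finset.card_range, nsmul_eq_mul]
    rcases lt_or_ge (v : ℕ) (k + 2) with h | h
    · rw [if_neg h.not_ge, if_pos h]
      rcases lt_or_ge (v : ℕ) 2 with h2 | h2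
      · rw [hY2 _ h2]
        rcases (show (v : ℕ) = 0 ∨ (v : ℕ) = 1 by omega) with h0 | h0 <;> simp [h0] <;> ring
      · have hYv : Y v = b * (r - 1) := by
          simp only [hY]
          rw [if_neg (by omega), if_pos h]
        rw [hYv, if_neg (by omega), if_neg (by omega)]
        ring
    · have hYv : Y v = r * (r - 1) := by
        simp only [hY]
        rw [if_neg (by omega), if_neg (by omega)]
      rw [hYv, if_pos h, if_neg h.not_gt, if_pos (by omega), if_pos (by omega)]
      linarith

/-- The spectral radius of `K⁺` is at least the root above `n / 2` of its cubic. -/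
lemma specRad_Kplus_bound {n : ℕ} (hn : 3 ≤ n) {l : ℝ} (hl : specRad (Kplus n) ≤ l) :
    ((n / 2 : ℕ) : ℝ) < l ∧
      2 * ((n / 2 : ℕ) : ℝ) ≤ (l ^ 2 - ((n + 1) / 2 : ℕ) * (n / 2 : ℕ)) * (l - 1) := by
  obtain ⟨k, hk⟩ : ∃ k, (n + 1) / 2 = k + 2 := ⟨(n + 1) / 2 - 2, by omega⟩
  obtain ⟨b, hb⟩ : ∃ b, n / 2 = b := ⟨_, rfl⟩
  have hn' : n = k + 2 + b := by omega
  rw [Kplus, hk] at hl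
  rw [hk, hb]
  subst hn'
  clear hb
  have hb1 : (1 : ℝ) ≤ b := by exact_mod_cast (show 1 ≤ b by omega)
  have hkb : (k : ℝ) + 2 = b ∨ (k : ℝ) + 2 = b + 1 := by
    rcases (show k + 2 = b ∨ k + 2 = b + 1 by omega) with h | h
    · left; exact_mod_cast h
    · right; exact_mod_cast h
  set f : ℝ → ℝ := fun r => (r ^ 2 - (k + 2) * b) * (r - 1) with hf
  have hcont : ContinuousOn f (Set.Icc (b : ℝ) (b + 1)) := by
    simp only [hf]; fun_prop
  have hfb : f b < 2 * b := by
    simp only [hf]; rcases hkb with h | h <;> rw [h] <;> nlinarith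
  have hfb1 : 2 * (b : ℝ) ≤ f (b + 1) := by
    simp only [hf]; rcases hkb with h | h <;> rw [h] <;> nlinarith
  obtain ⟨r, hr, hfr⟩ := intermediate_value_Icc (by linarith) hcont ⟨hfb.le, hfb1⟩
  have hbr : (b : ℝ) < r := by
    refine lt_of_le_of_ne hr.1 fun h => ?_
    rw [← h] at hfr
    exact hfb.ne hfr
  have hrl := (le_specRad_KbipPlus (by omega) (by linarith) hfr).trans hl
  refine ⟨by linarith, ?_⟩
  push_cast
  simp only [hf] at hfr
  have hpos : 0 < r ^ 2 - (k + 2) * b := by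
    by_contra hneg
    have := mul_nonpos_of_nonpos_of_nonneg (not_lt.1 hneg) (show 0 ≤ r - 1 by linarith)
    linarith
  have hsq : r ^ 2 ≤ l ^ 2 := by
    have : 0 ≤ r := by linarith
    gcongr
  rw [← hfr]
  exact mul_le_mul (by linarith) (by linarith) (by linarith) (by linarith)

end SpecRad

section Extremal

lemma triangleCount_eq_card_cliquesIn {V : Type*} [Fintype V] (G : SimpleGraph V) :
    triangleCount G = (cliquesIn G Finset.univ 3).card := by
  classical
  unfold triangleCount
  congr 1
  ext c
  simp only [mem_cliqueFinset_iff, mem_cliquesIn, isNClique_iff]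
  simp [and_comm]

lemma div_two_cases {n : ℕ} (hn : 3 ≤ n) :
    (1 : ℝ) ≤ (n / 2 : ℕ) ∧ (n : ℝ) = ((n + 1) / 2 : ℕ) + (n / 2 : ℕ) ∧
      ((((n + 1) / 2 : ℕ) : ℝ) = (n / 2 : ℕ) ∧ (2 : ℝ) ≤ (n / 2 : ℕ) ∨
        (((n + 1) / 2 : ℕ) : ℝ) = (n / 2 : ℕ) + 1) := by
  refine ⟨by exact_mod_cast (show 1 ≤ n / 2 by omega),
    by exact_mod_cast (show n = (n + 1) / 2 + n / 2 by omega), ?_⟩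
  rcases (show (n + 1) / 2 = n / 2 ∧ 2 ≤ n / 2 ∨ (n + 1) / 2 = n / 2 + 1 by omega) with h | h
  · exact Or.inl (by exact_mod_cast h)
  · exact Or.inr (by exact_mod_cast h)

lemma mul_div_two_eq (n : ℕ) : (n + 1) / 2 * (n / 2) = n ^ 2 / 4 := by
  rcases Nat.even_or_odd' n with ⟨k, rfl | rfl⟩
  · rw [show (2 * k + 1) / 2 = k by omega, show 2 * k / 2 = k by omega,
      show (2 * k) ^ 2 = k * k * 4 by ring, Nat.mul_div_cancel _ (by norm_num)]
  · rw [show (2 * k + 1 + 1) / 2 = k + 1 by omega, show (2 * k + 1) / 2 = k by omega,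
      show (2 * k + 1) ^ 2 = (k + 1) * k * 4 + 1 by ring]
    omega

variable {n : ℕ} {G : SimpleGraph (Fin n)} {x : Fin n → ℝ} {u : Fin n} {l : ℝ}

/-- Spectral radius at least that of `K⁺` and few triangles force more than `n² / 4` edges. -/
lemma sq_div_four_lt_card_cliquesIn_two (hn : 3 ≤ n)
    (ht : (cliquesIn G Finset.univ 3).card ≤ n / 2) (hl : specRad (Kplus n) ≤ l)
    (hpos : ∀ v, 0 < x v) (hu : ∀ v, x v ≤ x u)
    (heig : ∀ v, ∑ w ∈ nbrIn G Finset.univ v, x w = l * x v) :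
    n ^ 2 / 4 + 1 ≤ (cliquesIn G Finset.univ 2).card := by
  by_contra! hm
  obtain ⟨hbl, hroot⟩ := specRad_Kplus_bound hn hl
  obtain ⟨hb1, hnab, hab⟩ := div_two_cases hn
  have hm' : ((cliquesIn G Finset.univ 2).card : ℝ) ≤ ((n + 1) / 2 : ℕ) * (n / 2 : ℕ) := by
    exact_mod_cast (by rw [mul_div_two_eq]; omega :
      (cliquesIn G Finset.univ 2).card ≤ (n + 1) / 2 * (n / 2))
  have hd' : ((nbrIn G Finset.univ u).card : ℝ) ≤ n - 1 := by
    have h : (nbrIn G Finset.univ u).card < n := by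
      refine (Finset.card_lt_card ?_).trans_eq (Finset.card_fin n)
      exact Finset.ssubset_univ_iff.2 fun h =>
        G.irrefl (mem_nbrIn.1 (Finset.eq_univ_iff_forall.1 h u)).2
    have : ((nbrIn G Finset.univ u).card : ℝ) + 1 ≤ n := by exact_mod_cast h
    linarith
  have he : (cliquesIn G (nbrIn G Finset.univ u) 2).card ≤ n / 2 := by
    rw [← card_filter_mem_cliquesIn (Finset.mem_univ u)]
    exact (Finset.card_filter_le _ _).trans ht
  have he' : ((cliquesIn G (nbrIn G Finset.univ u) 2).card : ℝ) ≤ (n / 2 : ℕ) := by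
    exact_mod_cast he
  have ht' : ((cliquesIn G Finset.univ 3).card : ℝ) ≤ (n / 2 : ℕ) := by exact_mod_cast ht
  have hS := sum_compl_insert_nbrIn u heig
  have hW := sq_mul_sum_le (fun v => (hpos v).le) hu heig
  have hA := sq_mul_apply_le (fun v => (hpos v).le) hu heig
  have hX : 0 ≤ ∑ w ∈ (insert u (nbrIn G Finset.univ u))ᶜ, x w :=
    Finset.sum_nonneg fun w _ => (hpos w).le
  have hM := hpos u
  generalize ∑ w ∈ (insert u (nbrIn G Finset.univ u))ᶜ, x w = X at *
  generalize ∑ v, x v = S at *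
  generalize x u = M at *
  generalize ((cliquesIn G Finset.univ 2).card : ℝ) = m at *
  generalize ((cliquesIn G Finset.univ 3).card : ℝ) = t at *
  generalize ((cliquesIn G (nbrIn G Finset.univ u) 2).card : ℝ) = e at *
  generalize ((nbrIn G Finset.univ u).card : ℝ) = d at *
  generalize ((n / 2 : ℕ) : ℝ) = b at *
  generalize (((n + 1) / 2 : ℕ) : ℝ) = a at *
  generalize (n : ℝ) = N at *
  clear ht he hm heig hu hpos hl hn
  have hSpos : 0 < S := by
    rw [hS]
    have : 0 < l * M := mul_pos (by linarith) hM
    linarith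
  have hA' : (l ^ 2 - 2 * b) * M ≤ (N - 1) * (M + X) := by
    have h1 : e * M ≤ b * M := by gcongr
    have h2 : d * (M + X) ≤ (N - 1) * (M + X) := by gcongr
    linarith
  have hquad : 0 < 2 * l ^ 2 - (N - 1) * l + 3 * (N - 1) - 4 * b := by
    rcases hab with ⟨h, hb2⟩ | h <;> rw [hnab, h] <;> nlinarith
  have hbig : 3 * (l - 1) * M < 2 * S := by
    have hN : 0 < N - 1 := by rcases hab with ⟨h, hb2⟩ | h <;> rw [hnab, h] <;> linarith
    refine lt_of_mul_lt_mul_left ?_ hN.le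
    have := mul_pos hquad hM
    rw [hS]
    linarith
  have hgap : (l ^ 2 - a * b) * S ≤ 3 * b * M := by
    have h1 : m * S ≤ a * b * S := by gcongr
    have h2 : t * M ≤ b * M := by gcongr
    linarith
  have hl1 : 0 < l - 1 := by linarith
  have h1 := mul_le_mul_of_nonneg_left hgap hl1.le
  have h2 := mul_le_mul_of_nonneg_right hroot hSpos.le
  have h3 := mul_lt_mul_of_pos_left hbig (show 0 < b by linarith)
  linarith

/-- A vertex with maximal entry lies in at least two triangles if there are four or more vertices. -/
lemma two_le_card_cliquesIn_nbrIn (hn : 4 ≤ n) (hl : specRad (Kplus n) ≤ l)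
    (hpos : ∀ v, 0 < x v) (hu : ∀ v, x v ≤ x u)
    (heig : ∀ v, ∑ w ∈ nbrIn G Finset.univ v, x w = l * x v) :
    2 ≤ (cliquesIn G (nbrIn G Finset.univ u) 2).card := by
  by_contra! he
  obtain ⟨hbl, hroot⟩ := specRad_Kplus_bound (by omega) hl
  obtain ⟨-, hnab, hab⟩ := div_two_cases (n := n) (by omega)
  have hb2 : (2 : ℝ) ≤ (n / 2 : ℕ) := by exact_mod_cast (show 2 ≤ n / 2 by omega)
  have hA := sq_mul_apply_le (fun v => (hpos v).le) hu heig
  have hM := hpos u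
  have he' : ((cliquesIn G (nbrIn G Finset.univ u) 2).card : ℝ) ≤ 1 := by
    exact_mod_cast Nat.lt_succ_iff.1 he
  have hX : ∑ w ∈ (insert u (nbrIn G Finset.univ u))ᶜ, x w ≤
      (n - 1 - (nbrIn G Finset.univ u).card) * x u := by
    have hcard : ((insert u (nbrIn G Finset.univ u))ᶜ.card : ℝ) =
        n - 1 - (nbrIn G Finset.univ u).card := by
      have h1 := Finset.card_add_card_compl (insert u (nbrIn G Finset.univ u))
      rw [Finset.card_insert_of_notMem fun h => G.irrefl (mem_nbrIn.1 h).2, Fintype.card_fin] at h1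
      have h2 : ((nbrIn G Finset.univ u).card : ℝ) + 1 +
        ((insert u (nbrIn G Finset.univ u))ᶜ.card : ℝ) = n := by exact_mod_cast h1
      linarith
    rw [← hcard, ← nsmul_eq_mul]
    exact Finset.sum_le_card_nsmul _ _ _ fun w _ => hu w
  have hprod : ((nbrIn G Finset.univ u).card : ℝ) * (n - (nbrIn G Finset.univ u).card) ≤
      ((n + 1) / 2 : ℕ) * (n / 2 : ℕ) := by
    rcases hab with ⟨h, -⟩ | h
    · rw [hnab, h]
      nlinarith [sq_nonneg (((nbrIn G Finset.univ u).card : ℝ) - (n / 2 : ℕ))]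
    · rw [hnab, h]
      have hint : 0 ≤ (((nbrIn G Finset.univ u).card : ℤ) - (n / 2 : ℕ)) *
          (((nbrIn G Finset.univ u).card : ℤ) - (n / 2 : ℕ) - 1) := by
        rcases le_or_gt ((nbrIn G Finset.univ u).card : ℤ) (n / 2 : ℕ) with h | h
        · exact mul_nonneg_of_nonpos_of_nonpos (by linarith) (by linarith)
        · exact mul_nonneg (by linarith) (by omega)
      have hreal : (0 : ℝ) ≤ (((nbrIn G Finset.univ u).card : ℝ) - (n / 2 : ℕ)) *
          (((nbrIn G Finset.univ u).card : ℝ) - (n / 2 : ℕ) - 1) := by exact_mod_cast hint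
      linarith
  have hd0 : (0 : ℝ) ≤ (nbrIn G Finset.univ u).card := by positivity
  generalize ∑ w ∈ (insert u (nbrIn G Finset.univ u))ᶜ, x w = X at *
  generalize x u = M at *
  generalize ((cliquesIn G (nbrIn G Finset.univ u) 2).card : ℝ) = e at *
  generalize ((nbrIn G Finset.univ u).card : ℝ) = d at *
  generalize ((n / 2 : ℕ) : ℝ) = b at *
  generalize (((n + 1) / 2 : ℕ) : ℝ) = a at *
  generalize (n : ℝ) = N at *
  have hsq : l ^ 2 ≤ a * b + 2 := by
    refine le_of_mul_le_mul_right ?_ hM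
    have h1 : e * M ≤ 1 * M := by gcongr
    have h2 : d * X ≤ d * ((N - 1 - d) * M) := by gcongr
    have h3 : d * (N - d) * M ≤ a * b * M := by gcongr
    linarith
  have hl1 : b + 1 ≤ l := by
    have := mul_le_mul_of_nonneg_right (show l ^ 2 - a * b ≤ 2 by linarith)
      (show 0 ≤ l - 1 by linarith)
    linarith
  rcases hab with ⟨h, -⟩ | h <;> rw [h] at hsq <;> nlinarith

/-- If all triangles contain the edge `{u, v}`, the neighborhood of `u` induces a star. -/
lemma star_of_forall_subset {V : Type*} [Fintype V] [DecidableEq V] {G : SimpleGraph V} {u v : V}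
    (huv : G.Adj u v) (h : ∀ c ∈ cliquesIn G Finset.univ 3, {u, v} ⊆ c) :
    (nbrIn G (nbrIn G Finset.univ u) v).card = (cliquesIn G Finset.univ 3).card ∧
      ∀ a ∈ nbrIn G Finset.univ u, ∀ b ∈ nbrIn G Finset.univ u, G.Adj a b → v = a ∨ v = b := by
  have hstar : ∀ a ∈ nbrIn G Finset.univ u, ∀ b ∈ nbrIn G Finset.univ u, G.Adj a b →
      v = a ∨ v = b := by
    intro a ha b hb hab
    have hsub := h _ (insert_pair_mem_cliquesIn (Finset.mem_univ u) (Finset.mem_univ a)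
      (Finset.mem_univ b) (mem_nbrIn.1 ha).2 (mem_nbrIn.1 hb).2 hab)
    have hv : v ∈ ({u, a, b} : Finset V) := hsub (by simp)
    simpa [huv.ne'] using hv
  refine ⟨?_, hstar⟩
  have h1 := card_cliquesIn_succ (G := G) (k := 2) (Finset.mem_univ u)
  have h2 := card_cliquesIn_succ (G := G) (k := 1)
    (mem_nbrIn.2 ⟨Finset.mem_univ v, huv⟩ : v ∈ nbrIn G Finset.univ u)
  have h3 : cliquesIn G (Finset.univ.erase u) 3 = ∅ := by
    refine Finset.eq_empty_of_forall_notMem fun c hc => ?_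
    obtain ⟨hc1, hc2, hc3⟩ := mem_cliquesIn.1 hc
    have := h c (mem_cliquesIn.2 ⟨Finset.subset_univ c, hc2, hc3⟩) (Finset.mem_insert_self u {v})
    simpa using hc1 this
  have h4 : cliquesIn G ((nbrIn G Finset.univ u).erase v) 2 = ∅ := by
    refine Finset.eq_empty_of_forall_notMem fun e he => ?_
    obtain ⟨a, b, -, ha, hb, hab⟩ := exists_adj_of_mem_cliquesIn_two he
    rw [Finset.mem_erase] at ha hb
    rcases hstar a ha.2 b hb.2 hab with h | h
    · exact ha.1 h.symm
    · exact hb.1 h.symm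
  rw [card_cliquesIn_one] at h2
  norm_num [h3, h4] at h1 h2
  rw [h1, h2]

end Extremal

end SimpleGraph

open SimpleGraph
/-- In the Setup, with `t = t(G)`, the induced subgraph `G[A]` is the union of a star
`K_{1,t}` and isolated vertices: there is a centre `u₀ ∈ A` met by every edge inside
`A`, and `u₀` has exactly `t` neighbors inside `A`. -/
theorem setup_induced_nbhd_is_star
    (n : ℕ) (hn : 3 ≤ n) (G : SimpleGraph (Fin n)) [DecidableRel G.Adj]
    (ht : triangleCount G ≤ n / 2)
    (hspec : specRad (Kplus n) ≤ specRad G)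
    (hmaxspec : ∀ H : SimpleGraph (Fin n), triangleCount H ≤ n / 2 → specRad H ≤ specRad G)
    (hconn : G.Connected)
    (x : Fin n → ℝ) (hxpos : ∀ v, 0 < x v) (hxunit : ∑ v, x v ^ 2 = 1)
    (heig : SimpleGraph.adjMatrix ℝ G *ᵥ x = specRad G • x)
    (ustar : Fin n) (hustar : ∀ v, x v ≤ x ustar)
    :
    ∃ u₀ ∈ G.neighborFinset ustar,
      ((G.neighborFinset ustar).filter fun a => G.Adj u₀ a).card = triangleCount G ∧
        ∀ a ∈ G.neighborFinset ustar, ∀ b ∈ G.neighborFinset ustar,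
          G.Adj a b → u₀ = a ∨ u₀ = b := by
  rw [triangleCount_eq_card_cliquesIn] at ht ⊢
  have hnbr : ∀ v, G.neighborFinset v = nbrIn G Finset.univ v := fun v => by
    ext w
    simp [mem_nbrIn]
  have heig' : ∀ v, ∑ w ∈ nbrIn G Finset.univ v, x w = specRad G * x v := fun v => by
    rw [← hnbr, ← adjMatrix_mulVec_apply, heig]
    rfl
  have hm := sq_div_four_lt_card_cliquesIn_two hn ht hspec hxpos hustar heig'
  obtain ⟨-, ht1, hcommon⟩ := rademacher_cliquesIn n G Finset.univ (Finset.card_fin n) hm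
  obtain ⟨c, hc⟩ := Finset.card_pos.1 ht1
  obtain ⟨e, he, hec⟩ := hcommon ht
  obtain ⟨p, q, rfl, -, -, hpq⟩ := exists_adj_of_mem_cliquesIn_two he
  obtain ⟨v, huv, hsub⟩ :
      ∃ v, G.Adj ustar v ∧ ∀ c ∈ cliquesIn G Finset.univ 3, {ustar, v} ⊆ c := by
    by_cases hp : ustar = p
    · exact ⟨q, hp ▸ hpq, hp ▸ hec⟩
    by_cases hq : ustar = q
    · exact ⟨p, hq ▸ hpq.symm, by rw [hq, Finset.pair_comm]; exact hec⟩
    have hpqu : ∀ c ∈ cliquesIn G Finset.univ 3, ustar ∈ c → c = {ustar, p, q} := by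
      intro c hc hu
      refine (Finset.eq_of_subset_of_card_le (Finset.insert_subset hu (hec c hc)) ?_).symm
      rw [(mem_cliquesIn.1 hc).2.1, Finset.card_eq_three.2 ⟨_, _, _, hp, hq, hpq.ne, rfl⟩]
    rcases hn.eq_or_lt with rfl | hn4
    · have huniv : ∀ c ∈ cliquesIn G Finset.univ 3, c = Finset.univ := fun c hc =>
        (Finset.card_eq_iff_eq_univ c).1 (mem_cliquesIn.1 hc).2.1
      refine ⟨p, ?_, fun c hc => huniv c hc ▸ Finset.subset_univ _⟩
      have hcl := (mem_cliquesIn.1 hc).2.2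
      rw [huniv c hc] at hcl
      exact hcl (by simp) (by simp) hp
    · exfalso
      have h2 := two_le_card_cliquesIn_nbrIn hn4 hspec hxpos hustar heig'
      rw [← card_filter_mem_cliquesIn (Finset.mem_univ ustar)] at h2
      have h1 : ((cliquesIn G Finset.univ 3).filter (ustar ∈ ·)).card ≤ 1 := by
        refine Finset.card_le_one.2 fun c hc d hd => ?_
        rw [Finset.mem_filter] at hc hd
        rw [hpqu c hc.1 hc.2, hpqu d hd.1 hd.2]
      exact absurd (h2.trans h1) (by norm_num)
  obtain ⟨hcard, hstar⟩ := star_of_forall_subset huv hsub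
  rw [hnbr]
  refine ⟨v, mem_nbrIn.2 ⟨Finset.mem_univ v, huv⟩, ?_, hstar⟩
  rw [← hcard]
  congr 1
  ext a
  simp [mem_nbrIn]
end

section
/- In the Setup, B is an independent set of G; that is, G has no edge with both endpoints in B. -/
open Matrix

/-- A graph with more than `a * b` edges and at most `b` triangles, where `a + b` is the order and
`a - b ∈ {0, 1}`, has a vertex cut `σ` with at most one inner edge and no missing cross edge. -/
theorem exists_cut {V : Type*} [Fintype V] (α : V → V → ℤ)
    (h01 : ∀ u v, α u v = 0 ∨ α u v = 1) (hsymm : ∀ u v, α u v = α v u)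
    (a b : ℤ) (hab : a + b = Fintype.card V) (hba : b ≤ a) (hab' : a ≤ b + 1)
    (hM : 2 * (a * b) + 2 ≤ ∑ v, ∑ w, α v w)
    (hT : ∑ u, ∑ v, ∑ w, α u v * α u w * α v w ≤ 6 * b) :
    ∃ σ : V → ℤ, (∀ v, σ v = 0 ∨ σ v = 1) ∧
      ∑ v, ∑ w, α v w * (1 - σ v - σ w + 2 * (σ v * σ w)) < 4 ∧
      ∑ v, ∑ w, (1 - α v w) * (σ v + σ w - 2 * (σ v * σ w)) < 2 := by
  set d : V → ℤ := fun v => ∑ w, α v w with hd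
  set M := ∑ v, ∑ w, α v w with hMdef
  set J : V → ℤ := fun u =>
    ∑ v, ∑ w, α v w * (1 - α u v - α u w + 2 * (α u v * α u w)) with hJ
  have hMd : M = ∑ v, d v := rfl
  have hcol : ∀ w, ∑ v, α v w = d w := fun w => Finset.sum_congr rfl fun v _ => hsymm v w
  have hdsq : ∑ v, (d v - a) * (d v - b) = ∑ v, d v ^ 2 - (a + b) * M + (a + b) * (a * b) := by
    have : ∀ v, (d v - a) * (d v - b) = d v ^ 2 - (a + b) * d v + a * b := fun v => by ring
    simp only [this, Finset.sum_add_distrib, Finset.sum_sub_distrib, ← Finset.mul_sum,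
      Finset.sum_const, Finset.card_univ, nsmul_eq_mul, ← hab, hMd]
    ring
  have hD0 : ∀ v, 0 ≤ (d v - a) * (d v - b) := fun v => by
    rcases le_or_gt (d v) b with h | h
    · exact mul_nonneg_of_nonpos_of_nonpos (by linarith) (by linarith)
    · exact mul_nonneg (by linarith) (by linarith)
  have hJsum : ∑ u, J u = (a + b) * M - 2 * ∑ v, d v ^ 2
      + 2 * ∑ u, ∑ v, ∑ w, α u v * α u w * α v w := by
    have key : ∀ u v w, α v w * (1 - α u v - α u w + 2 * (α u v * α u w))
        = α v w - α v w * α u v - α v w * α u w + 2 * (α u v * α u w * α v w) := by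
      intros; ring
    have h1 : ∑ u, ∑ v, ∑ w, α v w * α u v = ∑ v, d v ^ 2 := by
      rw [Finset.sum_comm]
      refine Finset.sum_congr rfl fun v _ => ?_
      simp_rw [← Finset.sum_mul]
      rw [← Finset.mul_sum, hcol]; ring
    have h2 : ∑ u, ∑ v, ∑ w, α v w * α u w = ∑ v, d v ^ 2 := by
      rw [← h1]
      refine Finset.sum_congr rfl fun u _ => ?_
      rw [Finset.sum_comm]
      exact Finset.sum_congr rfl fun v _ => Finset.sum_congr rfl fun w _ => by rw [hsymm v w]
    simp only [hJ, key, Finset.sum_add_distrib, Finset.sum_sub_distrib, h1, h2,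
      ← Finset.mul_sum]
    rw [Finset.sum_const, Finset.card_univ, nsmul_eq_mul, ← hab]
    ring
  have hn : 0 < a + b := by
    by_contra h
    have : IsEmpty V := by
      rw [← Fintype.card_eq_zero_iff]; omega
    have : M = 0 := by simp [hMdef]
    nlinarith [mul_self_nonneg a, mul_self_nonneg b]
  have hlt : ∑ u, J u < 4 * (a + b) := by
    have hDnn : 0 ≤ ∑ v, (d v - a) * (d v - b) := Finset.sum_nonneg fun v _ => hD0 v
    rcases hba.eq_or_lt with h | h
    · have hDpos : 0 < ∑ v, (d v - a) * (d v - b) := by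
        refine lt_of_le_of_ne hDnn fun h0 => ?_
        have hall := (Finset.sum_eq_zero_iff_of_nonneg fun v _ => hD0 v).1 h0.symm
        have : ∀ v, d v = b := fun v => by
          have := hall v (Finset.mem_univ v)
          rw [← h] at this
          have := mul_self_eq_zero.1 this
          linarith
        have hMb : M = (a + b) * b := by
          rw [hMd, Finset.sum_congr rfl fun v _ => this v]
          simp [hab]
        rw [← h] at hMb hM
        linarith
      nlinarith
    · nlinarith
  obtain ⟨u, hu⟩ : ∃ u, J u < 4 := by
    by_contra! h
    have := Finset.sum_le_sum fun u (_ : u ∈ Finset.univ) => h u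
    rw [Finset.sum_const, Finset.card_univ, nsmul_eq_mul, ← hab] at this
    linarith
  refine ⟨α u, h01 u, hu, ?_⟩
  have hp : (d u - a) * (d u - b) = d u ^ 2 - (a + b) * d u + a * b := by ring
  have hC : ∑ v, ∑ w, (1 - α v w) * (α u v + α u w - 2 * (α u v * α u w))
      = 2 * (a + b) * d u - 2 * d u ^ 2 - M + J u := by
    have key : ∀ v w, (1 - α v w) * (α u v + α u w - 2 * (α u v * α u w))
        = α u v + α u w - 2 * (α u v * α u w) - α v w
          + α v w * (1 - α u v - α u w + 2 * (α u v * α u w)) := by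
      intros; ring
    simp only [hJ, key, Finset.sum_add_distrib, Finset.sum_sub_distrib, ← Finset.mul_sum,
      ← Finset.sum_mul, Finset.sum_const, Finset.card_univ, nsmul_eq_mul, ← hab]
    simp only [hMdef, hd]
    ring
  have := hD0 u
  linarith

theorem frobenius_trace_bound {V : Type*} [Fintype V]
    (B : Matrix V V ℝ) (hB : Bᵀ = B) :
    trace (B * B * B) ^ 2 ≤ trace (B * B) ^ 3 ∧ 0 ≤ trace (B * B) := by
  have htr : ∀ C D : Matrix V V ℝ, Dᵀ = D → trace (C * D) = ∑ p : V × V, C p.1 p.2 * D p.1 p.2 := by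
    intro C D hD
    rw [Fintype.sum_prod_type]
    refine Finset.sum_congr rfl fun i _ => Finset.sum_congr rfl fun j _ => ?_
    exact congrArg (C i j * ·) (congrFun (congrFun hD i) j)
  have hBB : (B * B)ᵀ = B * B := by rw [transpose_mul, hB]
  have h0 : 0 ≤ trace (B * B) := by
    rw [htr _ _ hB]; exact Finset.sum_nonneg fun p _ => mul_self_nonneg _
  have h4 : trace (B * B * (B * B)) ≤ trace (B * B) ^ 2 := by
    rw [htr _ _ hBB, htr _ _ hB, Fintype.sum_prod_type, Fintype.sum_prod_type, sq,
      Finset.sum_mul_sum]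
    refine Finset.sum_le_sum fun i _ => Finset.sum_le_sum fun j _ => ?_
    have := Finset.sum_mul_sq_le_sq_mul_sq Finset.univ (fun k => B i k) (fun k => B k j)
    have hs : ∀ k, B k j = B j k := fun k => congrFun (congrFun hB j) k
    simp only [mul_apply, ← sq]
    simpa only [hs] using this
  refine ⟨?_, h0⟩
  calc trace (B * B * B) ^ 2 ≤ trace (B * B * (B * B)) * trace (B * B) := by
        rw [htr _ _ hB, htr _ _ hBB, htr B _ hB]
        have := Finset.sum_mul_sq_le_sq_mul_sq Finset.univ (fun p : V × V => (B * B) p.1 p.2)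
          (fun p => B p.1 p.2)
        simpa only [← sq] using this
    _ ≤ trace (B * B) ^ 2 * trace (B * B) := mul_le_mul_of_nonneg_right h4 h0
    _ = _ := by ring

/-- Deflating a symmetric matrix by a unit eigenvector bounds its third moment by the second. -/
theorem trace_eigen_bound {V : Type*} [Fintype V]
    (A : Matrix V V ℝ) (hA : Aᵀ = A) (x : V → ℝ) (hx : ∑ v, x v ^ 2 = 1) (l : ℝ)
    (he : A *ᵥ x = l • x) :
    (trace (A * A * A) - l ^ 3) ^ 2 ≤ (trace (A * A) - l ^ 2) ^ 3 ∧
      l ^ 2 ≤ trace (A * A) := by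
  set X := vecMulVec x x with hX
  have hxx : x ⬝ᵥ x = 1 := by simpa [dotProduct, sq] using hx
  have hAX : A * X = l • X := by rw [hX, mul_vecMulVec, he, smul_vecMulVec]
  have hXT : Xᵀ = X := by rw [hX, transpose_vecMulVec]
  have hXA : X * A = l • X := by
    have := congrArg transpose hAX
    rwa [transpose_mul, transpose_smul, hXT, hA] at this
  have hXX : X * X = X := by rw [hX, vecMulVec_mul_vecMulVec, hxx]; simp
  have htr : trace X = 1 := by rw [hX, trace_vecMulVec, hxx]
  have h2 : (A - l • X) * (A - l • X) = A * A - l ^ 2 • X := by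
    simp only [mul_sub, sub_mul, Matrix.mul_smul, Matrix.smul_mul, hAX, hXA, hXX, smul_smul, sq]
    abel
  have h3 : (A - l • X) * (A - l • X) * (A - l • X) = A * A * A - l ^ 3 • X := by
    rw [h2]
    simp only [mul_sub, sub_mul, Matrix.mul_smul, Matrix.smul_mul, hAX, hXA, hXX, smul_smul,
      Matrix.mul_assoc]
    module
  have := frobenius_trace_bound (A - l • X) (by rw [transpose_sub, transpose_smul, hA, hXT])
  rw [h3, h2, trace_sub, trace_sub, trace_smul, trace_smul, htr] at this
  simpa using this

theorem sum_triangles_le {V : Type*} [Fintype V] [DecidableEq V] (G : SimpleGraph V)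
    [DecidableRel G.Adj] :
    ∑ u, ∑ v, ∑ w, (G.adjMatrix ℤ u v * G.adjMatrix ℤ u w * G.adjMatrix ℤ v w)
      ≤ 6 * ((G.cliqueFinset 3).card : ℤ) := by
  set T := (Finset.univ : Finset (V × V × V)).filter
    fun p => G.Adj p.1 p.2.1 ∧ G.Adj p.1 p.2.2 ∧ G.Adj p.2.1 p.2.2 with hT
  have h1 : ∑ u, ∑ v, ∑ w, (G.adjMatrix ℤ u v * G.adjMatrix ℤ u w * G.adjMatrix ℤ v w)
      = (T.card : ℤ) := by
    rw [hT, Finset.card_filter, Fintype.sum_prod_type]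
    simp_rw [Fintype.sum_prod_type]
    push_cast
    refine Finset.sum_congr rfl fun u _ => Finset.sum_congr rfl fun v _ =>
      Finset.sum_congr rfl fun w _ => ?_
    simp only [SimpleGraph.adjMatrix_apply]
    split_ifs <;> simp_all
  rw [h1]
  have h2 : T.card ≤ 6 * (T.image fun p => ({p.1, p.2.1, p.2.2} : Finset V)).card := by
    refine Finset.card_le_mul_card_image T 6 fun s hs => ?_
    obtain ⟨⟨x, y, z⟩, -, rfl⟩ := Finset.mem_image.1 hs
    refine (Finset.card_le_card (t := {(x, y, z), (x, z, y), (y, x, z), (y, z, x), (z, x, y),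
      (z, y, x)}) ?_).trans Finset.card_le_six
    rintro ⟨p, q, r⟩ h
    simp only [hT, Finset.mem_filter, Finset.mem_univ, true_and] at h
    obtain ⟨⟨hpq, hpr, hqr⟩, he⟩ := h
    have h1 := hpq.ne
    have h2 := hpr.ne
    have h3 := hqr.ne
    have hp : p ∈ ({x, y, z} : Finset V) := he ▸ by simp
    have hq : q ∈ ({x, y, z} : Finset V) := he ▸ by simp
    have hr : r ∈ ({x, y, z} : Finset V) := he ▸ by simp
    simp only [Finset.mem_insert, Finset.mem_singleton, Prod.mk.injEq] at *
    grind
  have h3 : (T.image fun p => ({p.1, p.2.1, p.2.2} : Finset V)) ⊆ G.cliqueFinset 3 := by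
    intro s hs
    obtain ⟨⟨x, y, z⟩, h, rfl⟩ := Finset.mem_image.1 hs
    simp only [hT, Finset.mem_filter, Finset.mem_univ, true_and] at h
    rw [SimpleGraph.mem_cliqueFinset_iff, SimpleGraph.is3Clique_triple_iff]
    exact h
  exact_mod_cast h2.trans (Nat.mul_le_mul_left 6 (Finset.card_le_card h3))

theorem le_specRad_of_eigenvector {V : Type*} [Fintype V] (G : SimpleGraph V)
    [DecidableRel G.Adj] (x : V → ℝ) (hx : x ≠ 0) (l : ℝ)
    (h : G.adjMatrix ℝ *ᵥ x = l • x) : l ≤ specRad G := by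
  classical
  unfold specRad
  refine le_csSup (Module.End.finite_hasEigenvalue _).bddAbove ?_
  refine Module.End.hasEigenvalue_of_hasEigenvector (x := x) ⟨?_, hx⟩
  rw [Module.End.mem_eigenspace_iff, Matrix.toLin'_apply, ← h]
  congr!

theorem sum_range_ite_of_forall {P : ℕ → Prop} [DecidablePred P] {f : ℕ → ℝ} {k : ℝ} {m : ℕ}
    (hP : ∀ i < m, P i) (hf : ∀ i < m, f i = k) :
    ∑ i ∈ Finset.range m, (if P i then f i else 0) = m * k := by
  rw [Finset.sum_congr rfl (g := fun _ => k)]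
  · simp
  · intro i hi
    rw [Finset.mem_range] at hi
    rw [if_pos (hP i hi), hf i hi]

theorem sum_range_ite_of_forall_not {P : ℕ → Prop} [DecidablePred P] {f : ℕ → ℝ} {m : ℕ}
    (hP : ∀ i < m, ¬ P i) :
    ∑ i ∈ Finset.range m, (if P i then f i else 0) = 0 :=
  Finset.sum_eq_zero fun i hi => if_neg (hP i (Finset.mem_range.1 hi))

theorem le_specRad_KbipPlus (c b n : ℕ) (hn : n = 2 + c + b) (hb : b ≠ 0) (l : ℝ) (hl : 1 < l)
    (hl' : (l ^ 2 - ((2 + c : ℕ) : ℝ) * b) * (l - 1) = 2 * b) :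
    l ≤ specRad (KbipPlus n (2 + c)) := by
  classical
  obtain ⟨g, hg⟩ : ∃ g : ℕ → ℝ, g = fun i =>
    if i < 2 then b * l else if i < 2 + c then b * (l - 1) else l * (l - 1) := ⟨_, rfl⟩
  have hg0 : ∀ i < 2, g i = b * l := fun i hi => by rw [hg]; exact if_pos hi
  have hg1 : ∀ i, 2 ≤ i → i < 2 + c → g i = b * (l - 1) := fun i hi hi' => by
    rw [hg]; exact (if_neg (by omega)).trans (if_pos hi')
  have hg2 : ∀ i, 2 + c ≤ i → g i = l * (l - 1) := fun i hi => by
    rw [hg]; exact (if_neg (by omega)).trans (if_neg (by omega))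
  clear hg
  have hsplit : ∀ F : ℕ → ℝ, ∑ i : Fin n, F i
      = F 0 + F 1 + ∑ i ∈ Finset.range c, F (2 + i) + ∑ i ∈ Finset.range b, F (2 + c + i) := by
    intro F
    rw [hn, Fin.sum_univ_eq_sum_range, Finset.sum_range_add, Finset.sum_range_add,
      Finset.sum_range_succ, Finset.sum_range_one]
  have hx : (fun i : Fin n => g i) ≠ 0 := fun h0 => by
    have h1 : g 0 = 0 := congrFun h0 (⟨0, by omega⟩ : Fin n)
    rw [hg0 0 (by norm_num)] at h1
    have : (0 : ℝ) < b := by positivity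
    nlinarith
  refine le_specRad_of_eigenvector _ _ hx l (funext fun v => ?_)
  obtain ⟨v, hv⟩ := v
  refine Eq.trans ?_ ((hsplit fun j => if v ≠ j ∧
    (((v < 2 + c ∧ 2 + c ≤ j) ∨ (v = 0 ∧ j = 1)) ∨
      ((j < 2 + c ∧ 2 + c ≤ v) ∨ (j = 0 ∧ v = 1))) then g j else 0).trans ?_)
  · change ∑ i : Fin n, _ = _
    refine Finset.sum_congr rfl fun i _ => ?_
    change (KbipPlus n (2 + c)).adjMatrix ℝ ⟨v, hv⟩ i * g i = _
    rw [SimpleGraph.adjMatrix_apply, ite_mul, one_mul, zero_mul]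
    exact if_congr (by simp [KbipPlus, Fin.ext_iff]) rfl rfl
  clear hsplit
  simp only [Pi.smul_apply, smul_eq_mul]
  by_cases h3 : v < 2 + c
  · rw [sum_range_ite_of_forall_not (by omega),
      sum_range_ite_of_forall (k := l * (l - 1)) (by omega) (fun i _ => hg2 _ (by omega))]
    by_cases h2 : v < 2
    · rw [hg0 v h2, hg0 0 (by norm_num), hg0 1 (by norm_num)]
      have : v = 0 ∨ v = 1 := by omega
      rcases this with rfl | rfl
      · rw [if_neg (by simp), if_pos (by simp)]; ring
      · rw [if_pos (by simp), if_neg (by simp)]; ring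
    · rw [if_neg (by omega), if_neg (by omega), hg1 v (by omega) h3]
      ring
  · rw [sum_range_ite_of_forall (k := b * (l - 1)) (by omega)
        (fun i _ => hg1 _ (by omega) (by omega)),
      sum_range_ite_of_forall_not (by omega), if_pos (by omega), if_pos (by omega),
      hg0 0 (by norm_num), hg0 1 (by norm_num), hg2 v (by omega)]
    push_cast at hl'
    linear_combination -hl'

theorem exists_le_specRad_Kplus (n : ℕ) (hn : 3 ≤ n) :
    ∃ l : ℝ, l ≤ specRad (Kplus n) ∧ 1 < l ∧ l ≤ (n / 2 : ℕ) + 1 ∧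
      (((n + 1) / 2 : ℕ) : ℝ) * (n / 2 : ℕ) + 2 ≤ l ^ 2 ∧
      (l ^ 2 - (((n + 1) / 2 : ℕ) : ℝ) * (n / 2 : ℕ)) * (l - 1) = 2 * (n / 2 : ℕ) := by
  obtain ⟨c, b, rfl, h1, h2⟩ : ∃ c b, n = 2 + c + b ∧ (n + 1) / 2 = 2 + c ∧ n / 2 = b :=
    ⟨(n + 1) / 2 - 2, n / 2, by omega, by omega, rfl⟩
  unfold Kplus
  rw [h1, h2]
  have hb1 : (1 : ℝ) ≤ b := by
    have : 1 ≤ b := by omega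
    exact_mod_cast this
  have hbc : (b : ℝ) ≤ (2 + c : ℕ) := by
    have : b ≤ 2 + c := by omega
    exact_mod_cast this
  have hcb : ((2 + c : ℕ) : ℝ) ≤ b + 1 := by
    have : 2 + c ≤ b + 1 := by omega
    exact_mod_cast this
  set a : ℝ := ((2 + c : ℕ) : ℝ) with ha
  have hab : 0 ≤ a * b := by positivity
  have hs : Real.sqrt (a * b + 2) ≤ b + 1 := by
    rw [Real.sqrt_le_left (by linarith)]
    nlinarith
  have hsq : Real.sqrt (a * b + 2) ^ 2 = a * b + 2 := Real.sq_sqrt (by linarith)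
  have hcont : ContinuousOn (fun l : ℝ => (l ^ 2 - a * b) * (l - 1))
      (Set.Icc (Real.sqrt (a * b + 2)) (b + 1)) := by fun_prop
  obtain ⟨l, ⟨hl1, hl2⟩, hl⟩ := intermediate_value_Icc hs hcont
    (show (2 * b : ℝ) ∈ Set.Icc _ _ from ⟨by simp only [hsq]; linarith, by
      nlinarith [mul_nonneg (by linarith : (0:ℝ) ≤ b)
        (by nlinarith : (0:ℝ) ≤ (b + 1) ^ 2 - a * b - 2)]⟩)
  have h0 := Real.sqrt_nonneg (a * b + 2)
  have hl2' : a * b + 2 ≤ l ^ 2 := by rw [← hsq]; gcongr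
  have hl3 : 1 < l := by nlinarith
  exact ⟨l, le_specRad_KbipPlus c b _ rfl (by omega) l hl3 hl, hl3, hl2, hl2', hl⟩

theorem edge_numeric (a b l : ℝ) (hb : 1 ≤ b)
    (hab : (a = 2 ∧ b = 1) ∨ (2 ≤ b ∧ (a = b + 1 ∨ a = b))) (hl1 : 1 < l)
    (hl2 : l ≤ b + 1) (hl3 : a * b + 2 ≤ l ^ 2)
    (hl : (l ^ 2 - a * b) * (l - 1) = 2 * b) (m : ℝ) (hm : 0 ≤ m)
    (hlm : l ^ 2 + m ^ 2 = 2 * (a * b)) : 6 * b < l ^ 3 - m ^ 3 := by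
  have hml : m < l := by nlinarith
  have hkey : (l - m) * (l + 2 * m) < 3 * (l + m) := by
    rcases hab with ⟨rfl, rfl⟩ | ⟨hb2, hab⟩
    · have hl4 : l = 2 := by nlinarith
      have hm0 : m = 0 := by
        subst hl4
        exact pow_eq_zero_iff two_ne_zero |>.1 (by linarith)
      subst hl4 hm0
      norm_num
    by_cases h32 : l - m < 3 / 2
    · nlinarith
    push Not at h32
    exfalso
    rcases hab with rfl | rfl
    · nlinarith
    · have h35 : l ≤ a + 3 / 5 := by
        by_contra! h
        have h1 : (a + 3 / 5) ^ 2 - a * a ≤ l ^ 2 - a * a := by nlinarith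
        have h2 : ((a + 3 / 5) ^ 2 - a * a) * (a + 3 / 5 - 1) ≤ (l ^ 2 - a * a) * (l - 1) := by
          apply mul_le_mul h1 (by linarith) (by linarith) (by nlinarith)
        nlinarith
      nlinarith
  have hlp : 0 < l + m := by linarith
  have hl2m : (l - m) * (l + m) * (l - 1) = 4 * b := by linear_combination 2 * hl - hlm * (l - 1)
  have h1 : (l ^ 3 - m ^ 3) * ((l + m) * (l - 1)) = 4 * b * (l ^ 2 + l * m + m ^ 2) := by
    linear_combination hl2m * (l ^ 2 + l * m + m ^ 2)
  have h2 : 6 * ((l + m) * (l - 1)) < 4 * (l ^ 2 + l * m + m ^ 2) := by nlinarith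
  have h3 : 0 < (l + m) * (l - 1) := mul_pos hlp (by linarith)
  refine lt_of_mul_lt_mul_right ?_ h3.le
  rw [h1]
  nlinarith

theorem card_lt_of_sum_lt {V : Type*} [Fintype V]
    (f : V → V → ℤ) (hf : ∀ v w, 0 ≤ f v w) (k : ℕ) (hk : ∑ v, ∑ w, f v w < k)
    (s : Finset (V × V)) (hs : ∀ p ∈ s, f p.1 p.2 = 1) :
    s.card < k := by
  have h1 : (s.card : ℤ) = ∑ p ∈ s, f p.1 p.2 := by
    rw [Finset.sum_congr rfl hs]; simp
  have h2 : ∑ p ∈ s, f p.1 p.2 ≤ ∑ p : V × V, f p.1 p.2 :=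
    Finset.sum_le_sum_of_subset_of_nonneg (Finset.subset_univ _) fun p _ _ => hf _ _
  rw [Fintype.sum_prod_type] at h2
  exact_mod_cast h1 ▸ h2.trans_lt hk

theorem adj_cut_structure {V : Type*} [Fintype V] (G : SimpleGraph V)
    [DecidableRel G.Adj] (σ : V → ℤ) (hσ : ∀ v, σ v = 0 ∨ σ v = 1)
    (hin : ∑ v, ∑ w, G.adjMatrix ℤ v w * (1 - σ v - σ w + 2 * (σ v * σ w)) < 4)
    (hcross : ∑ v, ∑ w, (1 - G.adjMatrix ℤ v w) * (σ v + σ w - 2 * (σ v * σ w)) < 2) :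
    (∀ v w, σ v ≠ σ w → G.Adj v w) ∧
      ∀ u v y z, G.Adj u v → σ u = σ v → G.Adj y z → σ y = σ z → u ≠ y → u ≠ z → False := by
  classical
  constructor
  · intro v w hvw
    by_contra hadj
    have hne : v ≠ w := fun h => hvw (by rw [h])
    have hadj' : ¬ G.Adj w v := fun h => hadj h.symm
    have := card_lt_of_sum_lt _ (fun v w => ?_) 2 (by exact_mod_cast hcross) {(v, w), (w, v)} ?_
    · rw [Finset.card_pair (by simp [hne])] at this
      exact lt_irrefl _ this
    · rw [SimpleGraph.adjMatrix_apply]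
      rcases hσ v with h | h <;> rcases hσ w with h' | h' <;> rw [h, h'] <;> split_ifs <;> norm_num
    · intro p hp
      simp only [Finset.mem_insert, Finset.mem_singleton] at hp
      rcases hp with rfl | rfl <;> rcases hσ v with h | h <;> rcases hσ w with h' | h' <;>
        simp_all [SimpleGraph.adjMatrix_apply]
  · intro u v y z huv hs hyz hs' huy huz
    have := card_lt_of_sum_lt _ (fun v w => ?_) 4 (by exact_mod_cast hin)
      {(u, v), (v, u), (y, z), (z, y)} ?_
    · rw [Finset.card_insert_of_notMem, Finset.card_insert_of_notMem, Finset.card_pair] at this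
      · exact lt_irrefl _ this
      · have := hyz.ne; simp [this]
      · simp only [Finset.mem_insert, Finset.mem_singleton, Prod.mk.injEq]; grind
      · have := huv.ne
        simp only [Finset.mem_insert, Finset.mem_singleton, Prod.mk.injEq]; grind
    · rw [SimpleGraph.adjMatrix_apply]
      rcases hσ v with h | h <;> rcases hσ w with h' | h' <;> rw [h, h'] <;> split_ifs <;> norm_num
    · intro p hp
      have huv' := huv.symm
      have hyz' := hyz.symm
      simp only [Finset.mem_insert, Finset.mem_singleton] at hp
      rcases hp with rfl | rfl | rfl | rfl <;> rcases hσ v with h | h <;>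
        rcases hσ z with h' | h' <;>
        simp_all [SimpleGraph.adjMatrix_apply]

theorem sum_adjMatrix_of_trace_bound {V : Type*} [Fintype V] (G : SimpleGraph V)
    [DecidableRel G.Adj] (x : V → ℝ) (hx : ∑ v, x v ^ 2 = 1) (l : ℝ)
    (he : G.adjMatrix ℝ *ᵥ x = l • x) :
    (((∑ u, ∑ v, ∑ w, G.adjMatrix ℤ u v * G.adjMatrix ℤ u w * G.adjMatrix ℤ v w : ℤ) : ℝ)
        - l ^ 3) ^ 2 ≤ (((∑ v, ∑ w, G.adjMatrix ℤ v w : ℤ) : ℝ) - l ^ 2) ^ 3 ∧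
      l ^ 2 ≤ ((∑ v, ∑ w, G.adjMatrix ℤ v w : ℤ) : ℝ) := by
  have hc : ∀ v w, ((G.adjMatrix ℤ v w : ℤ) : ℝ) = G.adjMatrix ℝ v w := fun v w => by
    simp only [SimpleGraph.adjMatrix_apply]; split_ifs <;> simp
  have hs : ∀ v w, G.adjMatrix ℝ v w = G.adjMatrix ℝ w v := fun v w => by
    simp only [SimpleGraph.adjMatrix_apply, G.adj_comm]
  have h2 : ((∑ v, ∑ w, G.adjMatrix ℤ v w : ℤ) : ℝ)
      = trace (G.adjMatrix ℝ * G.adjMatrix ℝ) := by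
    push_cast
    refine Finset.sum_congr rfl fun v _ => ?_
    rw [diag_apply, mul_apply]
    refine Finset.sum_congr rfl fun w _ => ?_
    rw [hc, hs w v, SimpleGraph.adjMatrix_apply]
    split_ifs <;> simp
  have h3 : ((∑ u, ∑ v, ∑ w, G.adjMatrix ℤ u v * G.adjMatrix ℤ u w * G.adjMatrix ℤ v w : ℤ) : ℝ)
      = trace (G.adjMatrix ℝ * G.adjMatrix ℝ * G.adjMatrix ℝ) := by
    push_cast
    refine Finset.sum_congr rfl fun u _ => ?_
    rw [diag_apply, mul_apply, Finset.sum_comm]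
    refine Finset.sum_congr rfl fun w _ => ?_
    rw [mul_apply, Finset.sum_mul]
    refine Finset.sum_congr rfl fun v _ => ?_
    rw [hc, hc, hc, hs w u]
    ring
  rw [h2, h3]
  exact trace_eigen_bound _ G.transpose_adjMatrix x hx l he

theorem mul_lt_half_sum_adjMatrix (a b l t m k : ℝ) (hb : 1 ≤ b)
    (hab : (a = 2 ∧ b = 1) ∨ (2 ≤ b ∧ (a = b + 1 ∨ a = b))) (hl1 : 1 < l)
    (hl2 : l ≤ b + 1) (hl3 : a * b + 2 ≤ l ^ 2)
    (hl : (l ^ 2 - a * b) * (l - 1) = 2 * b) (hlk : l ≤ k) (ht : t ≤ 6 * b)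
    (hcube : (t - k ^ 3) ^ 2 ≤ (m - k ^ 2) ^ 3) (hsq : k ^ 2 ≤ m) : 2 * (a * b) < m := by
  by_contra! hm
  have hlk2 : l ^ 2 ≤ k ^ 2 := by gcongr
  have hlk3 : l ^ 3 ≤ k ^ 3 := by gcongr
  have h0 : 0 ≤ 2 * (a * b) - l ^ 2 := by linarith
  have hr := Real.sqrt_nonneg (2 * (a * b) - l ^ 2)
  have hr2 := Real.sq_sqrt h0
  set r := Real.sqrt (2 * (a * b) - l ^ 2)
  have hnum := edge_numeric a b l hb hab hl1 hl2 hl3 hl r hr (by linarith)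
  have h1 : (m - k ^ 2) ^ 3 ≤ (r ^ 2) ^ 3 := by
    have : 0 ≤ m - k ^ 2 := by linarith
    gcongr
    linarith
  have h2 : (k ^ 3 - t) ^ 2 ≤ (r ^ 3) ^ 2 := by
    calc (k ^ 3 - t) ^ 2 = (t - k ^ 3) ^ 2 := by ring
      _ ≤ (r ^ 2) ^ 3 := hcube.trans h1
      _ = (r ^ 3) ^ 2 := by ring
  have h3 := abs_le_of_sq_le_sq h2 (by positivity)
  linarith [le_abs_self (k ^ 3 - t)]

theorem even_sum_adjMatrix {V : Type*} [Fintype V] (G : SimpleGraph V) [DecidableRel G.Adj] :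
    Even (∑ v, ∑ w, G.adjMatrix ℤ v w) := by
  classical
  have h : ∑ v, ∑ w, G.adjMatrix ℤ v w = ((∑ v, G.degree v : ℕ) : ℤ) := by
    push_cast
    refine Finset.sum_congr rfl fun v _ => ?_
    simp [SimpleGraph.adjMatrix_apply, ← SimpleGraph.card_neighborFinset_eq_degree,
      SimpleGraph.neighborFinset_eq_filter]
  rw [h, G.sum_degrees_eq_twice_card_edges]
  push_cast
  exact even_two_mul _

/-- In the Setup, `B = V ∖ (N(u*) ∪ {u*})` is an independent set of `G`. -/
theorem setup_B_independent
    (n : ℕ) (hn : 3 ≤ n) (G : SimpleGraph (Fin n)) [DecidableRel G.Adj]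
    (ht : triangleCount G ≤ n / 2)
    (hspec : specRad (Kplus n) ≤ specRad G)
    (hmaxspec : ∀ H : SimpleGraph (Fin n), triangleCount H ≤ n / 2 → specRad H ≤ specRad G)
    (hconn : G.Connected)
    (x : Fin n → ℝ) (hxpos : ∀ v, 0 < x v) (hxunit : ∑ v, x v ^ 2 = 1)
    (heig : SimpleGraph.adjMatrix ℝ G *ᵥ x = specRad G • x)
    (ustar : Fin n) (hustar : ∀ v, x v ≤ x ustar)
    :
    ∀ a b : Fin n, a ∈ Finset.univ \ insert ustar (G.neighborFinset ustar) →
      b ∈ Finset.univ \ insert ustar (G.neighborFinset ustar) → ¬ G.Adj a b := by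
  intro y z hy hz hyz
  simp only [Finset.mem_sdiff, Finset.mem_univ, Finset.mem_insert,
    SimpleGraph.mem_neighborFinset, true_and, not_or] at hy hz
  obtain ⟨hyu, huy⟩ := hy
  obtain ⟨hzu, huz⟩ := hz
  obtain ⟨l, hlspec, hl1, hl2, hl3, hl⟩ := exists_le_specRad_Kplus n hn
  have hlk := hlspec.trans hspec
  obtain ⟨hcube, hsq⟩ := sum_adjMatrix_of_trace_bound G x hxunit _ heig
  have hT : ∑ u, ∑ v, ∑ w, (G.adjMatrix ℤ u v * G.adjMatrix ℤ u w * G.adjMatrix ℤ v w)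
      ≤ 6 * ((n / 2 : ℕ) : ℤ) := by
    refine (sum_triangles_le G).trans ?_
    have : (G.cliqueFinset 3).card ≤ n / 2 := by
      unfold triangleCount at ht
      convert ht
    exact_mod_cast Nat.mul_le_mul_left 6 this
  have hpar : n = (n + 1) / 2 + n / 2 := by omega
  have hparts : ((n + 1) / 2 = 2 ∧ n / 2 = 1) ∨
      (2 ≤ n / 2 ∧ ((n + 1) / 2 = n / 2 + 1 ∨ (n + 1) / 2 = n / 2)) := by omega
  have hb1 : 1 ≤ n / 2 := by omega
  have hba : n / 2 ≤ (n + 1) / 2 := by omega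
  have hab : (n + 1) / 2 ≤ n / 2 + 1 := by omega
  generalize (n + 1) / 2 = a at *
  generalize n / 2 = b at *
  have hM := mul_lt_half_sum_adjMatrix (a : ℝ) b l _ _ _ (by exact_mod_cast hb1)
    (by exact_mod_cast hparts) hl1 hl2 hl3 hl hlk (by exact_mod_cast hT) hcube hsq
  have hM' : 2 * ((a : ℤ) * b) + 2 ≤ ∑ v, ∑ w, G.adjMatrix ℤ v w := by
    have h1 : 2 * ((a : ℤ) * b) < ∑ v, ∑ w, G.adjMatrix ℤ v w := by exact_mod_cast hM
    obtain ⟨k, hk⟩ := even_sum_adjMatrix G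
    omega
  obtain ⟨σ, hσ, hin, hcross⟩ := exists_cut (G.adjMatrix ℤ)
    (fun u v => by rw [SimpleGraph.adjMatrix_apply]; split_ifs <;> simp)
    (fun u v => by simp only [SimpleGraph.adjMatrix_apply, G.adj_comm])
    a b (by rw [Fintype.card_fin]; exact_mod_cast hpar.symm) (by exact_mod_cast hba)
    (by exact_mod_cast hab) hM' hT
  obtain ⟨hcut, hinner⟩ := adj_cut_structure G σ hσ hin hcross
  have hσy : σ ustar = σ y := by_contra fun h => huy (hcut _ _ h)
  have hσz : σ ustar = σ z := by_contra fun h => huz (hcut _ _ h)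
  have heig' : ∀ v, ∑ w ∈ G.neighborFinset v, x w = specRad G * x v := fun v => by
    rw [← SimpleGraph.adjMatrix_mulVec_apply, heig]; rfl
  have hsub : insert z (G.neighborFinset ustar) ⊆ G.neighborFinset y := by
    intro v hv
    rw [Finset.mem_insert, SimpleGraph.mem_neighborFinset] at hv
    rw [SimpleGraph.mem_neighborFinset]
    rcases hv with rfl | hv
    · exact hyz
    · refine hcut _ _ fun h => hinner ustar v y z hv (hσy.trans h) hyz (hσy.symm.trans hσz)
        (Ne.symm hyu) (Ne.symm hzu)
  have hle := Finset.sum_le_sum_of_subset_of_nonneg hsub fun v _ _ => (hxpos v).le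
  rw [Finset.sum_insert (by simpa using huz), heig', heig'] at hle
  have := mul_le_mul_of_nonneg_left (hustar y) (by linarith : (0 : ℝ) ≤ specRad G)
  linarith [hxpos z]
end
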